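/- arXiv:1510.03289 — 11 statements merged into one kernel-verified Lean document; each statement's English description precedes it below -/
import Mathlib

section
/- Let U ⊆ ℝⁿ be an open convex set and let f : U → ℝ be a C² function such that the second differential d²f(x) is a positive definite bilinear form for every x ∈ U. Then the gradient map ∇f : U → ℝⁿ, x ↦ ∇f(x), is injective, its image ∇f(U) is an open subset of ℝⁿ, and ∇f maps U diffeomorphically (with C¹ inverse) onto ∇f(U). -/
open scoped RealInnerProductSpace

section MonotoneVectorField

variable {E : Type*} [NormedAddCommGroup E] [InnerProductSpace ℝ E] {U : Set E} {G : E → E}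
  {G' : E → E →L[ℝ] E}

/-- A vector field on a convex set whose derivative is positive definite is injective. -/
theorem Convex.injOn_of_hasFDerivAt_inner_pos (hU : Convex ℝ U)
    (hG : ∀ x ∈ U, HasFDerivAt G (G' x) x)
    (hpos : ∀ x ∈ U, ∀ v, v ≠ 0 → 0 < ⟪G' x v, v⟫) : Set.InjOn G U := by
  intro x hx y hy hxy
  by_contra hne
  have hmem : ∀ t ∈ Set.Icc (0 : ℝ) 1, AffineMap.lineMap x y t ∈ U :=
    fun t ht => hU.lineMap_mem hx hy ht
  have hderiv : ∀ t ∈ Set.Icc (0 : ℝ) 1,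
      HasDerivAt (fun t : ℝ => ⟪G (AffineMap.lineMap x y t), y - x⟫)
        ⟪G' (AffineMap.lineMap x y t) (y - x), y - x⟫ t := by
    intro t ht
    have h := (hG _ (hmem t ht)).comp_hasDerivAt t AffineMap.hasDerivAt_lineMap
    simpa using h.inner ℝ (hasDerivAt_const t (y - x))
  obtain ⟨t, ht, h0⟩ := exists_hasDerivAt_eq_zero zero_lt_one
    (fun t ht => (hderiv t ht).continuousAt.continuousWithinAt) (by simp [hxy])
    fun t ht => hderiv t (Set.Ioo_subset_Icc_self ht)
  exact (hpos _ (hmem t (Set.Ioo_subset_Icc_self ht)) _ (sub_ne_zero.2 (Ne.symm hne))).ne' h0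

/-- An endomorphism of a finite-dimensional space with positive definite quadratic form is
invertible. -/
theorem ContinuousLinearMap.exists_equiv_of_inner_pos [FiniteDimensional ℝ E] (A : E →L[ℝ] E)
    (hA : ∀ v, v ≠ 0 → 0 < ⟪A v, v⟫) : ∃ e : E ≃L[ℝ] E, (e : E →L[ℝ] E) = A := by
  have hinj : Function.Injective A.toLinearMap := by
    refine (injective_iff_map_eq_zero _).2 fun v hv => ?_
    by_contra hne
    have hv' : A v = 0 := hv
    simpa [hv'] using hA v hne
  exact ⟨(LinearEquiv.ofInjectiveEndo A.toLinearMap hinj).toContinuousLinearEquiv, by ext; rfl⟩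

end MonotoneVectorField

section InverseFunction

variable {E F : Type*} [NormedAddCommGroup E] [NormedSpace ℝ E] [CompleteSpace E]
  [NormedAddCommGroup F] [NormedSpace ℝ F] {U : Set E} {G : E → F}

/-- The image of an open set under a map with invertible strict derivatives is open. -/
theorem IsOpen.image_of_hasStrictFDerivAt_equiv (hU : IsOpen U)
    (hG : ∀ x ∈ U, ∃ e : E ≃L[ℝ] F, HasStrictFDerivAt G (e : E →L[ℝ] F) x) :
    IsOpen (G '' U) := by
  rw [isOpen_iff_mem_nhds]
  rintro _ ⟨x, hx, rfl⟩
  obtain ⟨e, he⟩ := hG x hx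
  rw [← he.map_nhds_eq_of_equiv]
  exact Filter.image_mem_map (hU.mem_nhds hx)

/-- The inverse of an injective `C^n` map with invertible derivatives is `C^n`. -/
theorem Set.InjOn.contDiffOn_invFunOn {n : WithTop ℕ∞} (hinj : Set.InjOn G U) (hU : IsOpen U)
    (hn : n ≠ 0) (hG : ContDiffOn ℝ n G U)
    (hG' : ∀ x ∈ U, ∃ e : E ≃L[ℝ] F, HasFDerivAt G (e : E →L[ℝ] F) x) :
    ContDiffOn ℝ n (Function.invFunOn G U) (G '' U) := by
  rintro _ ⟨x, hx, rfl⟩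
  obtain ⟨e, he⟩ := hG' x hx
  have hGx := hG.contDiffAt (hU.mem_nhds hx)
  have hs := hGx.hasStrictFDerivAt' he hn
  have hmem : ∀ᶠ y in nhds (G x), hGx.localInverse he hn y ∈ U :=
    hs.localInverse_tendsto.eventually (hU.mem_nhds hx)
  refine ((hGx.to_localInverse he hn).congr_of_eventuallyEq ?_).contDiffWithinAt
  filter_upwards [hmem, hs.eventually_right_inverse] with y hy hGy
  calc Function.invFunOn G U y
      = Function.invFunOn G U (G (hGx.localInverse he hn y)) := congrArg _ hGy.symm
    _ = hGx.localInverse he hn y := hinj.leftInvOn_invFunOn hy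

end InverseFunction

section Gradient

variable {E : Type*} [NormedAddCommGroup E] [InnerProductSpace ℝ E] [CompleteSpace E]
  {f : E → ℝ} {U : Set E} {x : E}

/-- The gradient of a `C^(m+1)` function on an open set is `C^m`. -/
theorem ContDiffOn.gradient_of_isOpen {m n : WithTop ℕ∞} (hf : ContDiffOn ℝ n f U)
    (hU : IsOpen U) (hmn : m + 1 ≤ n) : ContDiffOn ℝ m (gradient f) U :=
  (InnerProductSpace.toDual ℝ E).symm.toContinuousLinearEquiv.toContinuousLinearMap.contDiff
    |>.comp_contDiffOn (hf.fderiv_of_isOpen hU hmn)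

/-- The derivative of the gradient represents the second derivative. -/
theorem inner_fderiv_gradient (hf : DifferentiableAt ℝ (fderiv ℝ f) x)
    (hg : DifferentiableAt ℝ (gradient f) x) (v w : E) :
    ⟪fderiv ℝ (gradient f) x v, w⟫ = fderiv ℝ (fderiv ℝ f) x v w := by
  have h₁ : HasFDerivAt (fun y => ⟪gradient f y, w⟫) _ x :=
    hg.hasFDerivAt.inner ℝ (hasFDerivAt_const w x)
  have h₂ : HasFDerivAt (fun y => fderiv ℝ f y w) _ x :=
    hf.hasFDerivAt.clm_apply (hasFDerivAt_const w x)
  have heq : (fun y => ⟪gradient f y, w⟫) = fun y => fderiv ℝ f y w := by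
    funext y
    simp [gradient]
  rw [heq] at h₁
  simpa using DFunLike.congr_fun (h₁.unique h₂) v

end Gradient

/-- Let `U ⊆ ℝⁿ` be an open convex set and `f : U → ℝ` a `C²` function whose
second differential `d²f(x)` is positive definite for every `x ∈ U`.  Then the gradient map
`∇f` is injective on `U`, its image `∇f(U)` is open, and `∇f` maps `U` diffeomorphically
(with `C¹` inverse) onto `∇f(U)`. -/
theorem gradient_image_open_and_diffeo
    {n : ℕ} (U : Set (EuclideanSpace ℝ (Fin n)))
    (hUopen : IsOpen U) (hUconv : Convex ℝ U)
    (f : EuclideanSpace ℝ (Fin n) → ℝ)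
    (hf : ContDiffOn ℝ 2 f U)
    (hpos : ∀ x ∈ U, ∀ v : EuclideanSpace ℝ (Fin n), v ≠ 0 →
      0 < iteratedFDerivWithin ℝ 2 f U x ![v, v]) :
    Set.InjOn (gradient f) U ∧
    IsOpen (gradient f '' U) ∧
    ∃ g : EuclideanSpace ℝ (Fin n) → EuclideanSpace ℝ (Fin n),
      Set.InvOn g (gradient f) U (gradient f '' U) ∧
      ContDiffOn ℝ 1 g (gradient f '' U) := by
  have hfd : ContDiffOn ℝ 1 (fderiv ℝ f) U := hf.fderiv_of_isOpen hUopen (by norm_num)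
  have hG : ContDiffOn ℝ 1 (gradient f) U := hf.gradient_of_isOpen hUopen (by norm_num)
  have hGd : ∀ x ∈ U, DifferentiableAt ℝ (gradient f) x := fun x hx =>
    (hG.contDiffAt (hUopen.mem_nhds hx)).differentiableAt one_ne_zero
  have hGpos : ∀ x ∈ U, ∀ v, v ≠ 0 → 0 < ⟪fderiv ℝ (gradient f) x v, v⟫ := by
    intro x hx v hv
    have h := hpos x hx v hv
    rw [iteratedFDerivWithin_of_isOpen 2 hUopen hx, iteratedFDeriv_two_apply] at h
    rw [inner_fderiv_gradient
      ((hfd.contDiffAt (hUopen.mem_nhds hx)).differentiableAt one_ne_zero) (hGd x hx)]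
    exact h
  have hequiv : ∀ x ∈ U, ∃ e : EuclideanSpace ℝ (Fin n) ≃L[ℝ] EuclideanSpace ℝ (Fin n),
      HasFDerivAt (gradient f) (e : EuclideanSpace ℝ (Fin n) →L[ℝ] _) x := by
    intro x hx
    obtain ⟨e, he⟩ := (fderiv ℝ (gradient f) x).exists_equiv_of_inner_pos (hGpos x hx)
    exact ⟨e, he ▸ (hGd x hx).hasFDerivAt⟩
  have hinj : Set.InjOn (gradient f) U :=
    hUconv.injOn_of_hasFDerivAt_inner_pos (fun x hx => (hGd x hx).hasFDerivAt) hGpos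
  refine ⟨hinj, hUopen.image_of_hasStrictFDerivAt_equiv fun x hx => ?_,
    Function.invFunOn (gradient f) U, hinj.bijOn_image.invOn_invFunOn,
    hinj.contDiffOn_invFunOn hUopen one_ne_zero hG hequiv⟩
  obtain ⟨e, he⟩ := hequiv x hx
  exact ⟨e, (hG.contDiffAt (hUopen.mem_nhds hx)).hasStrictFDerivAt' he one_ne_zero⟩
end

section
/- Let f : ℝⁿ → ℝ ∪ {+∞} be a convex function. Then the biconjugate f** = (f*)* equals the closure f̄ of f: the epigraph of f** is the topological closure of the epigraph of f, i.e. f**(x) = inf{ t ∈ ℝ : (x,t) ∈ cl(epi(f)) } for every x ∈ ℝⁿ. -/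
open scoped RealInnerProductSpace

/-- The epigraph of an `ℝ ∪ {+∞}`-valued function on `ℝⁿ`. -/
def epigraph {n : ℕ} (f : EuclideanSpace ℝ (Fin n) → EReal) :
    Set (EuclideanSpace ℝ (Fin n) × ℝ) :=
  {p | f p.1 ≤ (p.2 : EReal)}

/-- The Fenchel conjugate `f*(α) = sup_x (⟨α,x⟩ − f(x))`. -/
noncomputable def fenchelConj {n : ℕ} (f : EuclideanSpace ℝ (Fin n) → EReal)
    (α : EuclideanSpace ℝ (Fin n)) : EReal :=
  ⨆ x : EuclideanSpace ℝ (Fin n), ((⟪α, x⟫ : ℝ) : EReal) - f x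

/-- A nonempty finite-dimensional convex set contains a point from which every point of its
closure is seen along a segment lying in the set. -/
theorem Convex.exists_openSegment_closure_subset {V : Type*} [NormedAddCommGroup V]
    [NormedSpace ℝ V] [FiniteDimensional ℝ V] {s : Set V} (hs : Convex ℝ s) (hne : s.Nonempty) :
    ∃ p ∈ s, ∀ q ∈ closure s, openSegment ℝ p q ⊆ s := by
  obtain ⟨p, hp⟩ := hne.intrinsicInterior hs
  refine ⟨p, intrinsicInterior_subset hp, ?_⟩
  rintro q hq _ ⟨a, b, ha, hb, hab, rfl⟩
  have hqspan : q ∈ affineSpan ℝ s := by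
    rw [← intrinsicClosure_eq_closure ℝ s] at hq
    exact intrinsicClosure_subset_affineSpan hq
  obtain ⟨p', hp', rfl⟩ := mem_intrinsicInterior.1 hp
  obtain ⟨ε, hε, hball⟩ := Metric.mem_nhds_iff.1 (mem_interior_iff_mem_nhds.1 hp')
  obtain ⟨q', hq's, hqq'⟩ := Metric.mem_closure_iff.1 hq (a / b * ε) (by positivity)
  have hmem : (b / a) • (q -ᵥ q') +ᵥ (p' : V) ∈ affineSpan ℝ s :=
    AffineSubspace.vadd_mem_of_mem_direction
      (Submodule.smul_mem _ _
        (AffineSubspace.vsub_mem_direction hqspan (subset_affineSpan ℝ s hq's))) p'.2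
  have hmem_s : (b / a) • (q -ᵥ q') +ᵥ (p' : V) ∈ s := by
    refine hball (a := ⟨_, hmem⟩) ?_
    change dist ((b / a) • (q - q') + (p' : V)) p' < ε
    rw [dist_eq_norm, add_sub_cancel_right, norm_smul, Real.norm_of_nonneg (by positivity), ← dist_eq_norm]
    calc b / a * dist q q' < b / a * (a / b * ε) := by gcongr
      _ = ε := by field_simp
  have hcomb := hs hmem_s hq's ha.le hb.le hab
  convert hcomb using 1
  rw [vsub_eq_sub, vadd_eq_add, smul_add, smul_smul, mul_div_cancel₀ _ ha.ne', smul_sub]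
  abel

/-- A point outside the closure of the epigraph of a convex function is strictly separated from
the epigraph by a hyperplane that is vertical or has the epigraph above it. -/
theorem exists_separating_of_notMem_closure_epigraph {n : ℕ}
    {f : EuclideanSpace ℝ (Fin n) → EReal} (hconv : Convex ℝ (epigraph f))
    (hne : (epigraph f).Nonempty) {x : EuclideanSpace ℝ (Fin n)} {t : ℝ}
    (hx : (x, t) ∉ closure (epigraph f)) :
    ∃ (α : EuclideanSpace ℝ (Fin n)) (b u : ℝ), 0 ≤ b ∧
      (∀ y s, (y, s) ∈ epigraph f → ⟪α, y⟫ - b * s < u) ∧ u < ⟪α, x⟫ - b * t := by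
  obtain ⟨φ, u, hφ, hu⟩ := geometric_hahn_banach_closed_point hconv.closure isClosed_closure hx
  set α := (InnerProductSpace.toDual ℝ (EuclideanSpace ℝ (Fin n))).symm
    (φ.comp (ContinuousLinearMap.inl ℝ _ ℝ)) with hα
  have key : ∀ y s, φ (y, s) = ⟪α, y⟫ - (-φ (0, 1)) * s := by
    intro y s
    have h : ((y, s) : EuclideanSpace ℝ (Fin n) × ℝ) = (y, 0) + s • (0, 1) := by simp
    rw [h, map_add, map_smul, hα, InnerProductSpace.toDual_symm_apply]
    simp [mul_comm]
  have hlt : ∀ y s, (y, s) ∈ epigraph f → ⟪α, y⟫ - (-φ (0, 1)) * s < u := fun y s h => by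
    rw [← key]; exact hφ _ (subset_closure h)
  refine ⟨α, -φ (0, 1), u, ?_, hlt, by rwa [← key]⟩
  obtain ⟨⟨y, s⟩, hys⟩ := hne
  by_contra! hb
  set b := -φ (0, 1)
  have hup : (y, s + |u - (⟪α, y⟫ - b * s)| / (-b)) ∈ epigraph f := by
    refine le_trans (show f y ≤ (s : EReal) from hys) (EReal.coe_le_coe_iff.2 ?_)
    have : 0 ≤ |u - (⟪α, y⟫ - b * s)| / (-b) := div_nonneg (abs_nonneg _) (by linarith)
    linarith
  have h1 := hlt _ _ hup
  have h2 : b * (|u - (⟪α, y⟫ - b * s)| / (-b)) = -|u - (⟪α, y⟫ - b * s)| := by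
    rw [div_neg, mul_neg, mul_div_cancel₀ _ hb.ne]
  have h3 := le_abs_self (u - (⟪α, y⟫ - b * s))
  rw [mul_add, h2] at h1
  linarith

/-- A proper convex function on `ℝⁿ` has an affine minorant. -/
theorem exists_affine_minorant {n : ℕ} {f : EuclideanSpace ℝ (Fin n) → EReal}
    (hbot : ∀ x, f x ≠ ⊥) (hconv : Convex ℝ (epigraph f)) (hne : (epigraph f).Nonempty) :
    ∃ (α : EuclideanSpace ℝ (Fin n)) (c : ℝ), ∀ y s, (y, s) ∈ epigraph f → ⟪α, y⟫ - c ≤ s := by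
  obtain ⟨⟨x₀, t₀⟩, hp, hseg⟩ := hconv.exists_openSegment_closure_subset hne
  obtain ⟨T, hT⟩ : ∃ T : ℝ, (x₀, T) ∉ closure (epigraph f) := by
    by_contra! hall
    refine hbot x₀ (EReal.eq_bot_iff_forall_lt _ |>.2 fun s => ?_)
    have hmid : (x₀, s - 1) ∈ epigraph f := by
      refine hseg _ (hall (2 * (s - 1) - t₀))
        ⟨1 / 2, 1 / 2, by norm_num, by norm_num, by norm_num, ?_⟩
      ext1
      · simp [← add_smul]
        norm_num
      · simp
        ring
    exact lt_of_le_of_lt (show f x₀ ≤ ((s - 1 : ℝ) : EReal) from hmid)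
      (EReal.coe_lt_coe_iff.2 (by linarith))
  obtain ⟨α, b, u, hb, hA, hu⟩ := exists_separating_of_notMem_closure_epigraph hconv hne hT
  have hb' : 0 < b := hb.lt_of_ne' fun h => by
    have := hA _ _ hp
    simp only [h, zero_mul] at this hu
    linarith
  refine ⟨b⁻¹ • α, u / b, fun y s hys => ?_⟩
  have := hA y s hys
  rw [real_inner_smul_left, inv_mul_eq_div, ← sub_div, div_le_iff₀ hb']
  linarith

/-- A point outside the closure of the epigraph of a proper convex function lies strictly below
some affine minorant of the function. -/
theorem exists_affine_minorant_gt {n : ℕ} {f : EuclideanSpace ℝ (Fin n) → EReal}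
    (hbot : ∀ x, f x ≠ ⊥) (hconv : Convex ℝ (epigraph f)) (hne : (epigraph f).Nonempty)
    {x : EuclideanSpace ℝ (Fin n)} {t : ℝ} (hx : (x, t) ∉ closure (epigraph f)) :
    ∃ (α : EuclideanSpace ℝ (Fin n)) (c : ℝ),
      (∀ y s, (y, s) ∈ epigraph f → ⟪α, y⟫ - c ≤ s) ∧ t < ⟪α, x⟫ - c := by
  obtain ⟨α, b, u, hb, hA, hu⟩ := exists_separating_of_notMem_closure_epigraph hconv hne hx
  rcases hb.eq_or_lt with rfl | hb'
  · obtain ⟨β, c, hβ⟩ := exists_affine_minorant hbot hconv hne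
    simp only [zero_mul, sub_zero] at hA hu
    obtain ⟨k, hk⟩ := exists_nat_gt ((t - (⟪β, x⟫ - c)) / (⟪α, x⟫ - u))
    rw [div_lt_iff₀ (by linarith)] at hk
    refine ⟨β + (k : ℝ) • α, c + k * u, fun y s hys => ?_, ?_⟩
    · rw [inner_add_left, real_inner_smul_left]
      have h1 := hβ y s hys
      have h2 := mul_le_mul_of_nonneg_left (hA y s hys).le k.cast_nonneg
      linarith
    · rw [inner_add_left, real_inner_smul_left]
      linarith
  · refine ⟨b⁻¹ • α, u / b, fun y s hys => ?_, ?_⟩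
    · have := hA y s hys
      rw [real_inner_smul_left, inv_mul_eq_div, ← sub_div, div_le_iff₀ hb']
      linarith
    · rw [real_inner_smul_left, inv_mul_eq_div, ← sub_div, lt_div_iff₀ hb']
      linarith

/-- The conjugate at the slope of an affine minorant is bounded by minus the constant term. -/
theorem fenchelConj_le_of_affine_minorant {n : ℕ} {f : EuclideanSpace ℝ (Fin n) → EReal}
    (hbot : ∀ x, f x ≠ ⊥) {α : EuclideanSpace ℝ (Fin n)} {c : ℝ}
    (h : ∀ y s, (y, s) ∈ epigraph f → ⟪α, y⟫ - c ≤ s) : fenchelConj f α ≤ c := by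
  refine iSup_le fun y => ?_
  rcases hy : f y with _ | _ | r
  · exact absurd hy (hbot y)
  · exact (EReal.sub_top _).trans_le bot_le
  · have := h y r hy.le
    exact EReal.coe_le_coe_iff.2 (show ⟪α, y⟫ - r ≤ c by linarith)

/-- The Fenchel–Young inequality on the closure of the epigraph. -/
theorem inner_sub_le_fenchelConj_of_mem_closure_epigraph {n : ℕ}
    {f : EuclideanSpace ℝ (Fin n) → EReal} (α : EuclideanSpace ℝ (Fin n))
    {x : EuclideanSpace ℝ (Fin n)} {t : ℝ} (hx : (x, t) ∈ closure (epigraph f)) :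
    ((⟪α, x⟫ - t : ℝ) : EReal) ≤ fenchelConj f α := by
  have hclosed : IsClosed {p : EuclideanSpace ℝ (Fin n) × ℝ |
      ((⟪α, p.1⟫ - p.2 : ℝ) : EReal) ≤ fenchelConj f α} :=
    isClosed_le (continuous_coe_real_ereal.comp (by fun_prop)) continuous_const
  refine closure_minimal (fun p hp => ?_) hclosed hx
  refine le_trans ?_ (le_iSup (fun y => ((⟪α, y⟫ : ℝ) : EReal) - f y) p.1)
  rw [EReal.coe_sub]
  exact EReal.sub_le_sub le_rfl hp

/-- For a convex function `f : ℝⁿ → ℝ ∪ {+∞}`, the biconjugate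
`f** = (f*)*` equals the closure `f̄` of `f`:
`f**(x) = inf { t ∈ ℝ : (x,t) ∈ cl(epi f) }` for every `x`. -/
theorem biconjugate_eq_closure
    {n : ℕ} (f : EuclideanSpace ℝ (Fin n) → EReal)
    (hbot : ∀ x, f x ≠ ⊥)
    (hconv : Convex ℝ (epigraph f))
    (hdom : ∃ x, f x ≠ ⊤) :
    ∀ x : EuclideanSpace ℝ (Fin n),
      fenchelConj (fenchelConj f) x =
        sInf ((fun t : ℝ => (t : EReal)) '' {t : ℝ | (x, t) ∈ closure (epigraph f)}) := by
  intro x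
  obtain ⟨x₀, hx₀⟩ := hdom
  have hne : (epigraph f).Nonempty := ⟨(x₀, (f x₀).toReal), EReal.le_coe_toReal hx₀⟩
  apply le_antisymm
  · refine le_sInf ?_
    rintro _ ⟨t, ht, rfl⟩
    refine iSup_le fun α => ?_
    have h := inner_sub_le_fenchelConj_of_mem_closure_epigraph α ht
    rw [real_inner_comm]
    refine (EReal.sub_le_sub le_rfl h).trans ?_
    rw [← EReal.coe_sub, sub_sub_cancel]
  · by_contra! hlt
    obtain ⟨t, ht, ht'⟩ := EReal.lt_iff_exists_real_btwn.1 hlt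
    have hx : (x, t) ∉ closure (epigraph f) := fun hmem =>
      ht'.not_ge (sInf_le ⟨t, hmem, rfl⟩)
    obtain ⟨α, c, hα, hc⟩ := exists_affine_minorant_gt hbot hconv hne hx
    refine ht.not_ge (le_trans (EReal.coe_le_coe_iff.2 hc.le) ?_)
    refine le_trans ?_ (le_iSup (fun y => ((⟪x, y⟫ : ℝ) : EReal) - fenchelConj f y) α)
    rw [EReal.coe_sub, real_inner_comm]
    exact EReal.sub_le_sub le_rfl (fenchelConj_le_of_affine_minorant hbot hα)
end

section
/- Let f : ℝⁿ → ℝ ∪ {+∞} be a closed convex function. Then for x, α ∈ ℝⁿ the following three conditions are equivalent: (1) α ∈ ∂f(x); (2) f(x) + f*(α) = ⟨α,x⟩; (3) x ∈ ∂f*(α). -/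
open scoped RealInnerProductSpace

/-- The subdifferential `∂f(x)`: the set of `α` with `f(y) ≥ f(x) + ⟨α, y − x⟩` for all `y`. -/
def subdiff {n : ℕ} (f : EuclideanSpace ℝ (Fin n) → EReal)
    (x : EuclideanSpace ℝ (Fin n)) : Set (EuclideanSpace ℝ (Fin n)) :=
  {α | ∀ y, f x + ((⟪α, y - x⟫ : ℝ) : EReal) ≤ f y}

theorem fenchelConj_le_coe_iff {n : ℕ} {f : EuclideanSpace ℝ (Fin n) → EReal}
    {α : EuclideanSpace ℝ (Fin n)} {c : ℝ} :
    fenchelConj f α ≤ (c : EReal) ↔ ∀ y, ((⟪α, y⟫ - c : ℝ) : EReal) ≤ f y := by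
  refine iSup_le_iff.trans (forall_congr' fun y => ?_)
  induction f y with
  | bot => simp [-EReal.coe_sub]
  | top => simp
  | coe t =>
    norm_cast
    exact sub_le_comm

theorem coe_inner_sub_le_fenchelConj {n : ℕ} {f : EuclideanSpace ℝ (Fin n) → EReal}
    {x : EuclideanSpace ℝ (Fin n)} {a : ℝ} (hx : f x = a) (α : EuclideanSpace ℝ (Fin n)) :
    ((⟪α, x⟫ - a : ℝ) : EReal) ≤ fenchelConj f α := by
  have h := le_iSup (fun y => ((⟪α, y⟫ : ℝ) : EReal) - f y) x
  simp only [hx] at h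
  exact_mod_cast h

theorem exists_separating_of_lt {n : ℕ} {f : EuclideanSpace ℝ (Fin n) → EReal}
    (hconv : Convex ℝ (epigraph f)) (hclosed : IsClosed (epigraph f))
    {x : EuclideanSpace ℝ (Fin n)} {r : ℝ} (hr : (r : EReal) < f x) :
    ∃ (γ : EuclideanSpace ℝ (Fin n)) (s u : ℝ), ⟪γ, x⟫ + s * r < u ∧
      ∀ (y : EuclideanSpace ℝ (Fin n)) (t : ℝ), f y ≤ t → u < ⟪γ, y⟫ + s * t := by
  obtain ⟨L, u, hx, hL⟩ := geometric_hahn_banach_point_closed (x := (x, r)) hconv hclosed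
    (fun h => not_le_of_gt hr h)
  have key : ∀ (y : EuclideanSpace ℝ (Fin n)) (t : ℝ),
      L (y, t) = ⟪(InnerProductSpace.toDual ℝ _).symm
        (L.comp (ContinuousLinearMap.inl ℝ _ ℝ)), y⟫ + L (0, 1) * t := by
    intro y t
    have h : (y, t) = (y, (0 : ℝ)) + t • ((0 : EuclideanSpace ℝ (Fin n)), (1 : ℝ)) := by simp
    rw [h, map_add, map_smul, InnerProductSpace.toDual_symm_apply]
    simp [mul_comm]
  refine ⟨_, _, u, (key x r).symm.trans_lt hx, fun y t h => ?_⟩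
  rw [← key]
  exact hL (y, t) h

theorem exists_affine_minorant_of_pos {n : ℕ} {f : EuclideanSpace ℝ (Fin n) → EReal}
    (hbot : ∀ x, f x ≠ ⊥) {x γ : EuclideanSpace ℝ (Fin n)} {r s u : ℝ} (hs : 0 < s)
    (hx : ⟪γ, x⟫ + s * r < u)
    (h : ∀ (y : EuclideanSpace ℝ (Fin n)) (t : ℝ), f y ≤ t → u < ⟪γ, y⟫ + s * t) :
    ∃ (β : EuclideanSpace ℝ (Fin n)) (c : ℝ), r < ⟪β, x⟫ - c ∧
      ∀ y, ((⟪β, y⟫ - c : ℝ) : EReal) ≤ f y := by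
  have key : ∀ y, ⟪(-s⁻¹) • γ, y⟫ - (-s⁻¹ * u) = (u - ⟪γ, y⟫) / s := by
    intro y
    rw [real_inner_smul_left]
    ring
  refine ⟨(-s⁻¹) • γ, -s⁻¹ * u, ?_, fun y => ?_⟩
  · rw [key, lt_div_iff₀ hs]
    linarith
  · rw [key]
    induction hy : f y with
    | bot => exact absurd hy (hbot y)
    | top => exact le_top
    | coe t =>
      have := h y t hy.le
      rw [EReal.coe_le_coe_iff, div_le_iff₀ hs]
      linarith

/-- Every point strictly below the graph of a closed convex function lies strictly below
the graph of an affine minorant. -/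
theorem exists_affine_minorant_of_lt {n : ℕ} {f : EuclideanSpace ℝ (Fin n) → EReal}
    (hbot : ∀ x, f x ≠ ⊥) (hconv : Convex ℝ (epigraph f)) (hclosed : IsClosed (epigraph f))
    (hdom : ∃ x, f x ≠ ⊤) {x : EuclideanSpace ℝ (Fin n)} {r : ℝ} (hr : (r : EReal) < f x) :
    ∃ (β : EuclideanSpace ℝ (Fin n)) (c : ℝ), r < ⟪β, x⟫ - c ∧
      ∀ y, ((⟪β, y⟫ - c : ℝ) : EReal) ≤ f y := by
  obtain ⟨x₁, hx₁⟩ := hdom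
  lift f x₁ to ℝ using ⟨hx₁, hbot x₁⟩ with a ha
  obtain ⟨γ, s, u, hx, h⟩ := exists_separating_of_lt hconv hclosed hr
  rcases lt_trichotomy s 0 with hs | rfl | hs
  · have h₁ := h x₁ (max a ((u - ⟪γ, x₁⟫) / s)) (by rw [← ha]; exact_mod_cast le_max_left _ _)
    have h₂ := mul_le_mul_of_nonpos_left (le_max_right a ((u - ⟪γ, x₁⟫) / s)) hs.le
    rw [mul_div_cancel₀ _ hs.ne] at h₂
    linarith
  · obtain ⟨γ₀, s₀, u₀, hx₀, h₀⟩ := exists_separating_of_lt (r := a - 1) hconv hclosed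
      (by rw [← ha]; exact_mod_cast sub_one_lt a)
    have hs₀ : 0 < s₀ := by linarith [h₀ x₁ a ha.ge]
    obtain ⟨β, c, -, hβ⟩ := exists_affine_minorant_of_pos hbot hs₀ hx₀ h₀
    have hpos : 0 < u - ⟪γ, x⟫ := by linarith
    obtain ⟨k, hk⟩ := exists_nat_gt ((r - (⟪β, x⟫ - c)) / (u - ⟪γ, x⟫))
    rw [div_lt_iff₀ hpos] at hk
    have key : ∀ y, ⟪β - (k : ℝ) • γ, y⟫ - (c - k * u) = ⟪β, y⟫ - c + k * (u - ⟪γ, y⟫) := by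
      intro y
      rw [inner_sub_left, real_inner_smul_left]
      ring
    refine ⟨β - (k : ℝ) • γ, c - k * u, ?_, fun y => ?_⟩
    · rw [key]
      linarith
    · rw [key]
      have hy := hβ y
      induction hfy : f y with
      | bot => exact absurd hfy (hbot y)
      | top => exact le_top
      | coe t =>
        have h₁ := h y t hfy.le
        rw [hfy, EReal.coe_le_coe_iff] at hy
        rw [EReal.coe_le_coe_iff]
        have : (k : ℝ) * (u - ⟪γ, y⟫) ≤ 0 :=
          mul_nonpos_of_nonneg_of_nonpos k.cast_nonneg (by linarith)
        linarith
  · exact exists_affine_minorant_of_pos hbot hs hx h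

theorem add_fenchelConj_eq_of_mem_subdiff {n : ℕ} {f : EuclideanSpace ℝ (Fin n) → EReal}
    (hbot : ∀ x, f x ≠ ⊥) (hdom : ∃ x, f x ≠ ⊤) {x α : EuclideanSpace ℝ (Fin n)}
    (h : α ∈ subdiff f x) : f x + fenchelConj f α = ((⟪α, x⟫ : ℝ) : EReal) := by
  induction hx : f x with
  | bot => exact absurd hx (hbot x)
  | top =>
    obtain ⟨y, hy⟩ := hdom
    have := h y
    rw [hx, EReal.top_add_coe, top_le_iff] at this
    exact absurd this hy
  | coe a =>
    have hconj : fenchelConj f α = ((⟪α, x⟫ - a : ℝ) : EReal) := by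
      refine le_antisymm (fenchelConj_le_coe_iff.2 fun y => ?_)
        (coe_inner_sub_le_fenchelConj hx α)
      have := h y
      rw [hx, ← EReal.coe_add, inner_sub_right] at this
      convert this using 2
      ring
    rw [hconj, ← EReal.coe_add, add_sub_cancel]

theorem mem_subdiff_fenchelConj_of_add_eq {n : ℕ} {f : EuclideanSpace ℝ (Fin n) → EReal}
    {x α : EuclideanSpace ℝ (Fin n)}
    (h : f x + fenchelConj f α = ((⟪α, x⟫ : ℝ) : EReal)) : x ∈ subdiff (fenchelConj f) α := by
  intro β
  induction hx : f x with
  | bot => simp [hx] at h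
  | top =>
    rw [hx] at h
    induction hb : fenchelConj f α with
    | bot => simp
    | top => simp [hb] at h
    | coe b => simp [hb] at h
  | coe a =>
    have hβ := coe_inner_sub_le_fenchelConj hx β
    induction hb : fenchelConj f α with
    | bot => simp
    | top => simp [hx, hb] at h
    | coe b =>
      rw [hx, hb, ← EReal.coe_add, EReal.coe_eq_coe_iff] at h
      refine le_of_eq_of_le ?_ hβ
      rw [← EReal.coe_add, inner_sub_right, real_inner_comm β x, real_inner_comm α x, ← h]
      congr 1
      ring

theorem mem_subdiff_of_mem_subdiff_fenchelConj {n : ℕ}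
    {f : EuclideanSpace ℝ (Fin n) → EReal}
    (hbot : ∀ x, f x ≠ ⊥) (hconv : Convex ℝ (epigraph f)) (hclosed : IsClosed (epigraph f))
    (hdom : ∃ x, f x ≠ ⊤) {x α : EuclideanSpace ℝ (Fin n)}
    (h : x ∈ subdiff (fenchelConj f) α) : α ∈ subdiff f x := by
  induction hb : fenchelConj f α with
  | bot =>
    obtain ⟨y, hy⟩ := hdom
    lift f y to ℝ using ⟨hy, hbot y⟩ with a ha
    have := coe_inner_sub_le_fenchelConj ha.symm α
    rw [hb, le_bot_iff] at this
    exact absurd this (EReal.coe_ne_bot _)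
  | top =>
    obtain ⟨r, -, hr⟩ := EReal.lt_iff_exists_real_btwn.1 (bot_lt_iff_ne_bot.2 (hbot x))
    obtain ⟨β, c, -, hβ⟩ := exists_affine_minorant_of_lt hbot hconv hclosed hdom hr
    have := (h β).trans (fenchelConj_le_coe_iff.2 hβ)
    rw [hb, EReal.top_add_coe, top_le_iff] at this
    exact absurd this (EReal.coe_ne_top _)
  | coe b =>
    have hx : f x ≤ ((⟪α, x⟫ - b : ℝ) : EReal) := by
      by_contra! hr
      obtain ⟨β, c, hc, hβ⟩ := exists_affine_minorant_of_lt hbot hconv hclosed hdom hr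
      have := (h β).trans (fenchelConj_le_coe_iff.2 hβ)
      rw [hb, ← EReal.coe_add, EReal.coe_le_coe_iff, inner_sub_right, real_inner_comm β x,
        real_inner_comm α x] at this
      linarith
    intro y
    refine (add_le_add_left hx _).trans (le_of_eq_of_le ?_ (fenchelConj_le_coe_iff.1 hb.le y))
    rw [← EReal.coe_add, inner_sub_right]
    congr 1
    ring

/-- For a closed convex function `f : ℝⁿ → ℝ ∪ {+∞}` and `x, α ∈ ℝⁿ`,
the following are equivalent: (1) `α ∈ ∂f(x)`; (2) `f(x) + f*(α) = ⟨α,x⟩`;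
(3) `x ∈ ∂f*(α)`. -/
theorem subgradient_iff_conjugate_eq
    {n : ℕ} (f : EuclideanSpace ℝ (Fin n) → EReal)
    (hbot : ∀ x, f x ≠ ⊥)
    (hconv : Convex ℝ (epigraph f))
    (hclosed : IsClosed (epigraph f))
    (hdom : ∃ x, f x ≠ ⊤) :
    ∀ (x α : EuclideanSpace ℝ (Fin n)),
      (α ∈ subdiff f x ↔ f x + fenchelConj f α = ((⟪α, x⟫ : ℝ) : EReal)) ∧
      (α ∈ subdiff f x ↔ x ∈ subdiff (fenchelConj f) α) := by
  intro x α
  have h₁₂ := add_fenchelConj_eq_of_mem_subdiff hbot hdom (x := x) (α := α)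
  have h₂₃ := mem_subdiff_fenchelConj_of_add_eq (f := f) (x := x) (α := α)
  have h₃₁ := mem_subdiff_of_mem_subdiff_fenchelConj hbot hconv hclosed hdom (x := x) (α := α)
  exact ⟨⟨h₁₂, h₃₁ ∘ h₂₃⟩, ⟨h₂₃ ∘ h₁₂, h₃₁⟩⟩
end

section
/- Let f : ℝⁿ → ℝ ∪ {+∞} be a closed convex function. Then the range im(∂f) = ⋃_{x ∈ ℝⁿ} ∂f(x) of the subdifferential satisfies algint(D_{f*}) ⊆ im(∂f) ⊆ D_{f*}; in particular im(∂f) is an almost convex subset of ℝⁿ which is dense in the domain D_{f*} of the conjugate f*. -/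
open scoped RealInnerProductSpace

section EpigraphDuality

variable {X : Type*} [NormedAddCommGroup X] [InnerProductSpace ℝ X]

/-- The slopes `α` for which `⟨α, x⟩ - t` is bounded above on `E`. -/
def boundedSlopes (E : Set (X × ℝ)) : Set X :=
  {α | ∃ M : ℝ, ∀ q ∈ E, ⟪α, q.1⟫ - q.2 ≤ M}

/-- The slopes `α` for which `⟨α, x⟩ - t` attains its maximum on `E`. -/
def attainedSlopes (E : Set (X × ℝ)) : Set X :=
  {α | ∃ p ∈ E, ∀ q ∈ E, ⟪α, q.1⟫ - q.2 ≤ ⟪α, p.1⟫ - p.2}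

theorem attainedSlopes_subset_boundedSlopes (E : Set (X × ℝ)) :
    attainedSlopes E ⊆ boundedSlopes E :=
  fun _ ⟨_, _, h⟩ => ⟨_, h⟩

theorem convex_boundedSlopes (E : Set (X × ℝ)) : Convex ℝ (boundedSlopes E) := by
  rintro α ⟨M, hM⟩ β ⟨N, hN⟩ a b ha hb hab
  refine ⟨a * M + b * N, fun q hq => ?_⟩
  rw [inner_add_left, real_inner_smul_left, real_inner_smul_left]
  have h₁ := mul_le_mul_of_nonneg_left (hM q hq) ha
  have h₂ := mul_le_mul_of_nonneg_left (hN q hq) hb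
  have h₃ : q.2 = a * q.2 + b * q.2 := by rw [← add_mul, hab, one_mul]
  linarith

/-- First-order optimality: a minimizer of `t - ⟨α, x⟩ + s/2 ‖x‖²` on a convex set maximizes
`⟨α - s x, ·⟩ - t`. -/
theorem inner_sub_le_of_regularized_min {E : Set (X × ℝ)} (hE : Convex ℝ E) {α : X} {s : ℝ}
    {p : X × ℝ} (hp : p ∈ E)
    (hmin : ∀ q ∈ E, p.2 - ⟪α, p.1⟫ + s / 2 * ‖p.1‖ ^ 2 ≤ q.2 - ⟪α, q.1⟫ + s / 2 * ‖q.1‖ ^ 2)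
    {q : X × ℝ} (hq : q ∈ E) :
    ⟪α - s • p.1, q.1⟫ - q.2 ≤ ⟪α - s • p.1, p.1⟫ - p.2 := by
  set L : ℝ := q.2 - p.2 - ⟪α, q.1 - p.1⟫ + s * ⟪p.1, q.1 - p.1⟫ with hL
  have key : ∀ θ ∈ Set.Ioo (0 : ℝ) 1, 0 ≤ L + θ * (s / 2 * ‖q.1 - p.1‖ ^ 2) := by
    rintro θ ⟨h0, h1⟩
    have h := hmin _ (hE.add_smul_sub_mem hp hq ⟨h0.le, h1.le⟩)
    simp only [Prod.fst_add, Prod.snd_add, Prod.smul_fst, Prod.smul_snd, Prod.fst_sub,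
      Prod.snd_sub, smul_eq_mul] at h
    rw [norm_add_sq_real, inner_add_right, real_inner_smul_right, real_inner_smul_right,
      norm_smul, mul_pow, Real.norm_eq_abs, sq_abs] at h
    have : 0 ≤ θ * (L + θ * (s / 2 * ‖q.1 - p.1‖ ^ 2)) := by rw [hL]; linarith
    exact nonneg_of_mul_nonneg_right this h0
  have hL0 : 0 ≤ L := by
    have ht : Filter.Tendsto (fun θ : ℝ => L + θ * (s / 2 * ‖q.1 - p.1‖ ^ 2))
        (nhdsWithin 0 (Set.Ioi 0)) (nhds (L + 0 * (s / 2 * ‖q.1 - p.1‖ ^ 2))) :=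
      (Continuous.tendsto (by fun_prop) 0).mono_left nhdsWithin_le_nhds
    rw [zero_mul, add_zero] at ht
    refine ge_of_tendsto ht ?_
    filter_upwards [Ioo_mem_nhdsGT (zero_lt_one' ℝ)] with θ hθ using key θ hθ
  rw [hL, inner_sub_right, inner_sub_right] at hL0
  simp only [inner_sub_left, real_inner_smul_left]
  linarith

theorem exists_ball_subset_of_mem_intrinsicInterior {S : Set X} {α : X}
    (hα : α ∈ intrinsicInterior ℝ S) :
    ∃ ε > 0, ∀ v ∈ (affineSpan ℝ S).direction, ‖v‖ ≤ ε → α + v ∈ S := by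
  obtain ⟨y, hy, rfl⟩ := mem_intrinsicInterior.1 hα
  obtain ⟨ε, hε, hball⟩ := Metric.mem_nhds_iff.1 (mem_interior_iff_mem_nhds.1 hy)
  refine ⟨ε / 2, half_pos hε, fun v hv hvε => ?_⟩
  have hmem : (y : X) + v ∈ affineSpan ℝ S := by
    rw [add_comm]
    exact AffineSubspace.vadd_mem_of_mem_direction hv y.2
  have hmem' : (⟨(y : X) + v, hmem⟩ : affineSpan ℝ S) ∈ Metric.ball y ε := by
    rw [Metric.mem_ball, Subtype.dist_eq, dist_eq_norm, add_sub_cancel_left]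
    linarith
  exact hball hmem'

variable [FiniteDimensional ℝ X]

theorem exists_regularized_min {E : Set (X × ℝ)} (hE : IsClosed E) (hne : E.Nonempty)
    (hb : (boundedSlopes E).Nonempty) (α : X) {s : ℝ} (hs : 0 < s) :
    ∃ p ∈ E, ∀ q ∈ E,
      p.2 - ⟪α, p.1⟫ + s / 2 * ‖p.1‖ ^ 2 ≤ q.2 - ⟪α, q.1⟫ + s / 2 * ‖q.1‖ ^ 2 := by
  obtain ⟨d, M, hM⟩ := hb
  obtain ⟨q₀, hq₀⟩ := hne
  set φ : X × ℝ → ℝ := fun q => q.2 - ⟪α, q.1⟫ + s / 2 * ‖q.1‖ ^ 2 with hφ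
  have hφc : Continuous φ := by fun_prop
  set C := φ q₀
  set b := |C + M|
  set K := 2 * (‖d - α‖ + b) / s + 1 with hK
  have ha : 0 ≤ ‖d - α‖ := norm_nonneg _
  have hb0 : 0 ≤ b := abs_nonneg _
  have hK1 : 1 ≤ K := by rw [hK]; linarith [show 0 ≤ 2 * (‖d - α‖ + b) / s by positivity]
  have hsK : s / 2 * K = ‖d - α‖ + b + s / 2 := by rw [hK]; field_simp
  set T : Set (X × ℝ) := E ∩ {q | φ q ≤ C}
  have hTc : IsClosed T := hE.inter (isClosed_le hφc continuous_const)
  have hTb : T ⊆ Metric.closedBall 0 K ×ˢ Set.Icc (-(‖d‖ * K) - M) (C + ‖α‖ * K) := by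
    rintro ⟨x, t⟩ ⟨hqE, hqC⟩
    have hd : ⟪d, x⟫ - t ≤ M := hM _ hqE
    have hC : t - ⟪α, x⟫ + s / 2 * ‖x‖ ^ 2 ≤ C := hqC
    have h₁ : -(‖d - α‖ * ‖x‖) ≤ ⟪d - α, x⟫ := neg_le_of_abs_le (abs_real_inner_le_norm _ _)
    have h₂ : -(‖d‖ * ‖x‖) ≤ ⟪d, x⟫ := neg_le_of_abs_le (abs_real_inner_le_norm _ _)
    have h₃ : ⟪α, x⟫ ≤ ‖α‖ * ‖x‖ := real_inner_le_norm _ _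
    have hCM : C + M ≤ b := le_abs_self _
    rw [inner_sub_left] at h₁
    have hx : ‖x‖ ≤ K := by
      by_contra! hlt
      have h₄ : s / 2 * K * ‖x‖ ≤ s / 2 * ‖x‖ * ‖x‖ := by gcongr
      rw [hsK] at h₄
      have h₅ : b * 1 ≤ b * ‖x‖ := mul_le_mul_of_nonneg_left (by linarith) hb0
      have h₆ : 0 < s * ‖x‖ := mul_pos hs (by linarith)
      nlinarith
    have h₇ : ‖d‖ * ‖x‖ ≤ ‖d‖ * K := by gcongr
    have h₈ : ‖α‖ * ‖x‖ ≤ ‖α‖ * K := by gcongr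
    have h₉ : 0 ≤ s / 2 * ‖x‖ ^ 2 := by positivity
    refine ⟨by simpa using hx, ?_, ?_⟩ <;> dsimp only <;> linarith
  have hTk : IsCompact T :=
    ((isCompact_closedBall 0 K).prod isCompact_Icc).of_isClosed_subset hTc hTb
  obtain ⟨p, hpT, hp⟩ := hTk.exists_isMinOn ⟨q₀, hq₀, le_refl C⟩ hφc.continuousOn
  refine ⟨p, hpT.1, fun q hq => ?_⟩
  rcases le_total (φ q) C with h | h
  · exact hp ⟨hq, h⟩
  · exact le_trans hpT.2 h

theorem boundedSlopes_subset_closure_attainedSlopes {E : Set (X × ℝ)} (hE : IsClosed E)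
    (hconv : Convex ℝ E) (hne : E.Nonempty) :
    boundedSlopes E ⊆ closure (attainedSlopes E) := by
  intro α hα
  obtain ⟨M, hM⟩ := id hα
  obtain ⟨q₀, hq₀⟩ := id hne
  rw [Metric.mem_closure_iff]
  intro ε hε
  set A := |q₀.2 - ⟪α, q₀.1⟫ + M|
  set B := 2 * A + ‖q₀.1‖ ^ 2 + 1
  have hA : 0 ≤ A := abs_nonneg _
  have hB : 0 < B := by positivity
  set s := min 1 (ε ^ 2 / B / 2)
  have hs : 0 < s := lt_min one_pos (by positivity)
  have hs1 : s ≤ 1 := min_le_left _ _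
  have hsB : s * B < ε ^ 2 := by
    have h : s ≤ ε ^ 2 / B / 2 := min_le_right _ _
    calc s * B ≤ ε ^ 2 / B / 2 * B := by gcongr
      _ = ε ^ 2 / 2 := by field_simp
      _ < ε ^ 2 := half_lt_self (by positivity)
  obtain ⟨p, hp, hmin⟩ := exists_regularized_min hE hne ⟨α, hα⟩ α hs
  refine ⟨α - s • p.1, ⟨p, hp, fun q hq => inner_sub_le_of_regularized_min hconv hp hmin hq⟩, ?_⟩
  rw [dist_eq_norm, sub_sub_cancel, norm_smul, Real.norm_of_nonneg hs.le]
  refine lt_of_pow_lt_pow_left₀ 2 hε.le (lt_of_le_of_lt ?_ hsB)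
  have h₁ := hmin q₀ hq₀
  have h₂ := hM p hp
  have h₃ : q₀.2 - ⟪α, q₀.1⟫ + M ≤ A := le_abs_self _
  have h₄ : s * ‖q₀.1‖ ^ 2 ≤ 1 * ‖q₀.1‖ ^ 2 := by gcongr
  have h₅ : s * ‖p.1‖ ^ 2 ≤ B := by simp only [B]; linarith
  calc (s * ‖p.1‖) ^ 2 = s * (s * ‖p.1‖ ^ 2) := by ring
    _ ≤ s * B := by gcongr

/-- If every direction of length `ε` in `V` leads from `α` into the closure of the bounded slopes,
then `t - ⟨α, x⟩` grows linearly along `V`. -/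
theorem exists_linear_growth {E : Set (X × ℝ)} {V : Submodule ℝ X} {α : X} {ε : ℝ} (hε : 0 < ε)
    (hV : ∀ v ∈ V, ‖v‖ ≤ ε → α + v ∈ closure (boundedSlopes E)) :
    ∃ M : ℝ, ∀ q ∈ E, q.1 ∈ V → ε / 2 * ‖q.1‖ - M ≤ q.2 - ⟪α, q.1⟫ := by
  have hK : IsCompact ((V : Set X) ∩ Metric.closedBall 0 ε) :=
    (isCompact_closedBall 0 ε).inter_left V.closed_of_finiteDimensional
  have hcov : ∃ M : ℝ, ∀ u ∈ (V : Set X) ∩ Metric.closedBall 0 ε, ∀ q ∈ E,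
      ε • q.1 = ‖q.1‖ • u → ε / 2 * ‖q.1‖ - M ≤ q.2 - ⟪α, q.1⟫ := by
    refine hK.induction_on (p := fun K => ∃ M : ℝ, ∀ u ∈ K, ∀ q ∈ E,
      ε • q.1 = ‖q.1‖ • u → ε / 2 * ‖q.1‖ - M ≤ q.2 - ⟪α, q.1⟫) ⟨0, by simp⟩ ?_ ?_ ?_
    · rintro K K' hKK' ⟨M, hM⟩
      exact ⟨M, fun u hu => hM u (hKK' hu)⟩
    · rintro K K' ⟨M, hM⟩ ⟨N, hN⟩
      refine ⟨max M N, fun u hu q hq hqu => ?_⟩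
      rcases hu with hu | hu
      · linarith [hM u hu q hq hqu, le_max_left M N]
      · linarith [hN u hu q hq hqu, le_max_right M N]
    · rintro u ⟨huV, huε⟩
      obtain ⟨d, ⟨M, hM⟩, hd⟩ := Metric.mem_closure_iff.1 (hV u huV (by simpa using huε)) (ε / 4)
        (by positivity)
      refine ⟨Metric.ball u (ε / 4), mem_nhdsWithin_of_mem_nhds (Metric.ball_mem_nhds u
        (by positivity)), M, fun w hw q hq hqw => ?_⟩
      have hdw : ‖α + w - d‖ ≤ ε / 2 := by
        rw [← dist_eq_norm]
        have := dist_triangle (α + w) (α + u) d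
        rw [dist_add_left] at this
        linarith [Metric.mem_ball.1 hw]
      have h₁ : ⟪α + w - d, q.1⟫ ≤ ε / 2 * ‖q.1‖ :=
        (real_inner_le_norm _ _).trans (by gcongr)
      have h₂ : ⟪w, q.1⟫ = ε * ‖q.1‖ := by
        rcases eq_or_ne q.1 0 with h0 | h0
        · simp [h0]
        · have h0' : ‖q.1‖ ≠ 0 := norm_ne_zero_iff.2 h0
          have := congrArg (fun z => ⟪z, q.1⟫) hqw
          simp only [real_inner_smul_left, real_inner_self_eq_norm_sq] at this
          refine mul_left_cancel₀ h0' ?_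
          rw [← this]; ring
      rw [inner_sub_left, inner_add_left] at h₁
      linarith [hM q hq]
  obtain ⟨M, hM⟩ := hcov
  refine ⟨M, fun q hq hqV => ?_⟩
  rcases eq_or_ne q.1 0 with h0 | h0
  · exact hM 0 ⟨V.zero_mem, by simpa using hε.le⟩ q hq (by simp [h0])
  · have h0' : ‖q.1‖ ≠ 0 := norm_ne_zero_iff.2 h0
    refine hM ((ε / ‖q.1‖) • q.1) ⟨V.smul_mem _ hqV, ?_⟩ q hq ?_
    · rw [mem_closedBall_zero_iff, norm_smul, Real.norm_of_nonneg (by positivity),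
        div_mul_cancel₀ _ h0']
    · rw [smul_smul, mul_div_cancel₀ _ h0']

theorem intrinsicInterior_subset_attainedSlopes {E : Set (X × ℝ)} (hE : IsClosed E)
    (hconv : Convex ℝ E) (hne : E.Nonempty) {S : Set X} (hS : attainedSlopes E ⊆ S)
    (hS' : S ⊆ closure (boundedSlopes E)) :
    intrinsicInterior ℝ S ⊆ attainedSlopes E := by
  intro α hα
  have hαS : α ∈ S := intrinsicInterior_subset hα
  have hb : (boundedSlopes E).Nonempty := closure_nonempty_iff.1 ⟨α, hS' hαS⟩
  obtain ⟨ε, hε, hball⟩ := exists_ball_subset_of_mem_intrinsicInterior hα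
  set V := (affineSpan ℝ S).direction
  obtain ⟨M, hM⟩ := exists_linear_growth (V := V) hε fun v hv hvε => hS' (hball v hv hvε)
  set s : ℕ → ℝ := fun k => 1 / ((k : ℝ) + 1)
  have hs : ∀ k, 0 < s k := fun k => Nat.one_div_pos_of_nat
  have hs1 : ∀ k, s k ≤ 1 := fun k => by
    simp only [s]; rw [div_le_one (by positivity)]; linarith [k.cast_nonneg (α := ℝ)]
  choose p hpE hmin using fun k => exists_regularized_min hE hne hb α (hs k)
  have hpV : ∀ k, (p k).1 ∈ V := fun k => by
    have hmem : α - s k • (p k).1 ∈ S :=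
      hS ⟨p k, hpE k, fun q hq => inner_sub_le_of_regularized_min hconv (hpE k) (hmin k) hq⟩
    have := AffineSubspace.vsub_mem_direction (subset_affineSpan ℝ S hαS)
      (subset_affineSpan ℝ S hmem)
    rw [vsub_eq_sub, sub_sub_cancel] at this
    exact (V.smul_mem_iff (hs k).ne').1 this
  have hle : ∀ k, ∀ q ∈ E, (p k).2 - ⟪α, (p k).1⟫ ≤ q.2 - ⟪α, q.1⟫ + s k / 2 * ‖q.1‖ ^ 2 :=
    fun k q hq => by
      have := hmin k q hq
      have h : 0 ≤ s k / 2 * ‖(p k).1‖ ^ 2 := by have := hs k; positivity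
      linarith
  obtain ⟨q₀, hq₀⟩ := id hne
  set C := q₀.2 - ⟪α, q₀.1⟫ + 1 / 2 * ‖q₀.1‖ ^ 2
  have hC : ∀ k, (p k).2 - ⟪α, (p k).1⟫ ≤ C := fun k => by
    refine (hle k q₀ hq₀).trans ?_
    simp only [C]
    gcongr
    exact hs1 k
  set R := (C + M) / (ε / 2)
  have hpR : ∀ k, ‖(p k).1‖ ≤ R := fun k => by
    rw [le_div_iff₀ (half_pos hε)]
    linarith [hC k, hM _ (hpE k) (hpV k)]
  have hpK : ∀ k, p k ∈ Metric.closedBall (0 : X) R ×ˢ Set.Icc (-M - ‖α‖ * R) (C + ‖α‖ * R) :=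
    fun k => by
      have h₁ := abs_le.1 (abs_real_inner_le_norm α (p k).1)
      have h₂ : ‖α‖ * ‖(p k).1‖ ≤ ‖α‖ * R := by gcongr; exact hpR k
      have h₃ : 0 ≤ ε / 2 * ‖(p k).1‖ := by positivity
      refine ⟨by simpa using hpR k, ?_, ?_⟩ <;> linarith [hC k, hM _ (hpE k) (hpV k)]
  obtain ⟨x, -, ψ, hψ, hx⟩ :=
    ((isCompact_closedBall (0 : X) R).prod isCompact_Icc).tendsto_subseq hpK
  refine ⟨x, hE.mem_of_tendsto hx (Filter.Eventually.of_forall fun k => hpE (ψ k)),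
    fun q hq => ?_⟩
  have hs0 : Filter.Tendsto (s ∘ ψ) Filter.atTop (nhds 0) :=
    (tendsto_one_div_add_atTop_nhds_zero_nat (𝕜 := ℝ)).comp hψ.tendsto_atTop
  have hl : Filter.Tendsto (fun k => (p (ψ k)).2 - ⟪α, (p (ψ k)).1⟫) Filter.atTop
      (nhds (x.2 - ⟪α, x.1⟫)) :=
    ((show Continuous fun y : X × ℝ => y.2 - ⟪α, y.1⟫ by fun_prop).tendsto x).comp hx
  have hr : Filter.Tendsto (fun k => q.2 - ⟪α, q.1⟫ + s (ψ k) / 2 * ‖q.1‖ ^ 2) Filter.atTop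
      (nhds (q.2 - ⟪α, q.1⟫ + 0 / 2 * ‖q.1‖ ^ 2)) :=
    ((show Continuous fun r : ℝ => q.2 - ⟪α, q.1⟫ + r / 2 * ‖q.1‖ ^ 2 by fun_prop).tendsto 0).comp
      hs0
  have := le_of_tendsto_of_tendsto' hl hr fun k => hle (ψ k) q hq
  linarith

end EpigraphDuality

theorem setOf_fenchelConj_ne_top {n : ℕ} {f : EuclideanSpace ℝ (Fin n) → EReal}
    (hbot : ∀ x, f x ≠ ⊥) : {α | fenchelConj f α ≠ ⊤} = boundedSlopes (epigraph f) := by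
  ext α
  constructor
  · intro h
    obtain ⟨M, hM, -⟩ := EReal.lt_iff_exists_real_btwn.1 (lt_top_iff_ne_top.2 h)
    refine ⟨M, fun q hq => ?_⟩
    have h₁ : ((⟪α, q.1⟫ : ℝ) : EReal) - f q.1 ≤ M :=
      (le_iSup (fun x => ((⟪α, x⟫ : ℝ) : EReal) - f x) q.1).trans hM.le
    have h₂ : ((⟪α, q.1⟫ : ℝ) : EReal) - (q.2 : EReal) ≤ M :=
      (EReal.sub_le_sub le_rfl hq).trans h₁
    exact_mod_cast h₂
  · rintro ⟨M, hM⟩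
    refine ne_top_of_le_ne_top (EReal.coe_ne_top M) (iSup_le fun x => ?_)
    by_cases hx : f x = ⊤
    · simp [hx]
    · lift f x to ℝ using ⟨hx, hbot x⟩ with r hr
      have := hM (x, r) hr.ge
      exact_mod_cast this

theorem iUnion_subdiff_eq {n : ℕ} {f : EuclideanSpace ℝ (Fin n) → EReal}
    (hbot : ∀ x, f x ≠ ⊥) (hdom : ∃ x, f x ≠ ⊤) :
    (⋃ x, subdiff f x) = attainedSlopes (epigraph f) := by
  ext α
  rw [Set.mem_iUnion]
  constructor
  · rintro ⟨x, hx⟩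
    have hxtop : f x ≠ ⊤ := fun h => by
      obtain ⟨y, hy⟩ := hdom
      have := hx y
      rw [h, EReal.top_add_coe, top_le_iff] at this
      exact hy this
    have hr : ((f x).toReal : EReal) = f x := EReal.coe_toReal hxtop (hbot x)
    refine ⟨(x, (f x).toReal), hr.ge, fun q hq => ?_⟩
    have h : f x + ((⟪α, q.1 - x⟫ : ℝ) : EReal) ≤ q.2 := (hx q.1).trans hq
    rw [← hr] at h
    have hle : (f x).toReal + ⟪α, q.1 - x⟫ ≤ q.2 := by exact_mod_cast h
    rw [inner_sub_right] at hle
    dsimp only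
    linarith
  · rintro ⟨p, hp, hmax⟩
    refine ⟨p.1, fun y => ?_⟩
    refine (add_le_add_left (show f p.1 ≤ (p.2 : EReal) from hp) _).trans ?_
    by_cases hy : f y = ⊤
    · simp [hy]
    · have hr : ((f y).toReal : EReal) = f y := EReal.coe_toReal hy (hbot y)
      have h := hmax (y, (f y).toReal) hr.ge
      rw [← hr, inner_sub_right]
      dsimp only at h
      have hle : p.2 + (⟪α, y⟫ - ⟪α, p.1⟫) ≤ (f y).toReal := by linarith
      exact_mod_cast hle

/-- For a closed convex function `f : ℝⁿ → ℝ ∪ {+∞}` the range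
`im(∂f) = ⋃ₓ ∂f(x)` of the subdifferential satisfies
`algint(D_{f*}) ⊆ im(∂f) ⊆ D_{f*}`; in particular `im(∂f)` is almost convex
(its closure is convex and contains its relative interior) and dense in `D_{f*}`. -/
theorem range_subdiff_almost_convex_dense
    {n : ℕ} (f : EuclideanSpace ℝ (Fin n) → EReal)
    (hbot : ∀ x, f x ≠ ⊥)
    (hconv : Convex ℝ (epigraph f))
    (hclosed : IsClosed (epigraph f))
    (hdom : ∃ x, f x ≠ ⊤) :
    intrinsicInterior ℝ {α | fenchelConj f α ≠ ⊤} ⊆ (⋃ x, subdiff f x) ∧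
    (⋃ x, subdiff f x) ⊆ {α | fenchelConj f α ≠ ⊤} ∧
    Convex ℝ (closure (⋃ x, subdiff f x)) ∧
    intrinsicInterior ℝ (closure (⋃ x, subdiff f x)) ⊆ (⋃ x, subdiff f x) ∧
    {α | fenchelConj f α ≠ ⊤} ⊆ closure (⋃ x, subdiff f x) := by
  have hne : (epigraph f).Nonempty := by
    obtain ⟨x, hx⟩ := hdom
    exact ⟨(x, (f x).toReal), (EReal.coe_toReal hx (hbot x)).ge⟩
  rw [setOf_fenchelConj_ne_top hbot, iUnion_subdiff_eq hbot hdom]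
  have hsub := attainedSlopes_subset_boundedSlopes (epigraph f)
  have hdense := boundedSlopes_subset_closure_attainedSlopes hclosed hconv hne
  refine ⟨intrinsicInterior_subset_attainedSlopes hclosed hconv hne hsub subset_closure, hsub, ?_,
    intrinsicInterior_subset_attainedSlopes hclosed hconv hne subset_closure (closure_mono hsub),
    hdense⟩
  rw [(closure_mono hsub).antisymm (closure_minimal hdense isClosed_closure)]
  exact (convex_boundedSlopes _).closure
end

section
/- Let f : ℝⁿ → ℝ ∪ {+∞} be a closed convex function whose domain D_f has nonempty interior and whose restriction to Int(D_f) is a C²-Legendre function. Then ∂f(x) = ∅ for every boundary point x ∈ ∂D_f of the domain. -/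
open scoped RealInnerProductSpace Topology

/-- `g` is a `C²`-Legendre function on the open convex set `U`: it is `C²` with everywhere
positive definite second differential, and for every `x ∈ U`, `y ∈ ∂U`, the directional
derivative `⟨∇g(x + t(y−x)), y−x⟩` tends to `+∞` as `t → 1⁻`. -/
def IsLegendreC2 {n : ℕ} (U : Set (EuclideanSpace ℝ (Fin n)))
    (g : EuclideanSpace ℝ (Fin n) → ℝ) : Prop :=
  ContDiffOn ℝ 2 g U ∧
  (∀ x ∈ U, ∀ v : EuclideanSpace ℝ (Fin n), v ≠ 0 →
    0 < iteratedFDerivWithin ℝ 2 g U x ![v, v]) ∧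
  ∀ x ∈ U, ∀ y ∈ frontier U,
    Filter.Tendsto (fun t : ℝ => ⟪gradient g (x + t • (y - x)), y - x⟫)
      (𝓝[<] (1 : ℝ)) Filter.atTop

theorem convex_setOf_ne_top_of_convex_epigraph {n : ℕ} {f : EuclideanSpace ℝ (Fin n) → EReal}
    (hconv : Convex ℝ (epigraph f)) : Convex ℝ {x | f x ≠ ⊤} := by
  have h : {x | f x ≠ ⊤} =
      LinearMap.fst ℝ (EuclideanSpace ℝ (Fin n)) ℝ '' epigraph f := by
    ext x
    simp only [Set.mem_ofPred_eq, Set.mem_image, LinearMap.fst_apply, epigraph, Prod.exists]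
    constructor
    · intro hx
      exact ⟨x, (f x).toReal, EReal.le_coe_toReal hx, rfl⟩
    · rintro ⟨y, t, hy, rfl⟩
      exact ne_top_of_le_ne_top (EReal.coe_ne_top t) hy
  rw [h]
  exact hconv.linear_image _

/-- A function differentiable at `t` which lies below the chord joining `(t, φ t)` to `(1, b)`
has derivative at `t` at most the slope of that chord. -/
theorem deriv_mul_le_of_le_chord {φ : ℝ → ℝ} {d t b : ℝ} (ht : t < 1)
    (hd : HasDerivAt φ d t)
    (hφ : ∀ s ∈ Set.Ioo t 1, (1 - t) * φ s ≤ (1 - s) * φ t + (s - t) * b) :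
    (1 - t) * d ≤ b - φ t := by
  have hlim := (hasDerivWithinAt_iff_tendsto_slope' (s := Set.Ioi t) (by simp)).1
    hd.hasDerivWithinAt
  have hle : d ≤ (b - φ t) / (1 - t) := by
    refine le_of_tendsto hlim ?_
    filter_upwards [Ioo_mem_nhdsGT ht] with s hs
    have h1 : 0 < s - t := sub_pos.2 hs.1
    rw [slope_def_field, div_le_div_iff₀ h1 (sub_pos.2 ht)]
    linarith [hφ s hs]
  rwa [le_div_iff₀ (sub_pos.2 ht), mul_comm] at hle

/-- Let `f : ℝⁿ → ℝ ∪ {+∞}` be a closed convex function whose domain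
`D_f` has nonempty interior and whose restriction to `Int(D_f)` is a `C²`-Legendre function.
Then `∂f(x) = ∅` for every boundary point `x ∈ ∂D_f`. -/
theorem subdiff_empty_on_frontier_of_legendre
    {n : ℕ} (f : EuclideanSpace ℝ (Fin n) → EReal)
    (hbot : ∀ x, f x ≠ ⊥)
    (hconv : Convex ℝ (epigraph f))
    (hclosed : IsClosed (epigraph f))
    (hdom : ∃ x, f x ≠ ⊤)
    (hint : (interior {x | f x ≠ ⊤}).Nonempty)
    (g : EuclideanSpace ℝ (Fin n) → ℝ)
    (hg : ∀ x ∈ interior {x | f x ≠ ⊤}, f x = ((g x : ℝ) : EReal))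
    (hLeg : IsLegendreC2 (interior {x | f x ≠ ⊤}) g) :
    ∀ x ∈ frontier {x | f x ≠ ⊤}, subdiff f x = ∅ := by
  intro x hx
  have hD := convex_setOf_ne_top_of_convex_epigraph hconv
  set U := interior {x | f x ≠ ⊤} with hU
  have hUo : IsOpen U := isOpen_interior
  have hxcl : x ∈ closure {x | f x ≠ ⊤} := hx.1
  have hxU : x ∈ frontier U := by
    refine ⟨?_, by rw [hUo.interior_eq]; exact hx.2⟩
    rwa [hD.closure_interior_eq_closure_of_nonempty_interior hint]
  refine Set.eq_empty_of_forall_notMem fun α hα => ?_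
  have hα' : ∀ y, f x + ((⟪α, y - x⟫ : ℝ) : EReal) ≤ f y := hα
  obtain ⟨x₀, hx₀⟩ := hint
  have hfx : f x ≠ ⊤ := by
    intro htop
    have h := hα' x₀
    rw [htop, EReal.top_add_coe, hg x₀ hx₀] at h
    exact EReal.coe_ne_top _ (top_le_iff.1 h)
  obtain ⟨b, hb⟩ : ∃ b : ℝ, f x = b := ⟨_, (EReal.coe_toReal hfx (hbot x)).symm⟩
  have hmem : ∀ t ∈ Set.Ico (0 : ℝ) 1, x₀ + t • (x - x₀) ∈ U := by
    intro t ht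
    have h := hD.combo_interior_closure_mem_interior hx₀ hxcl (sub_pos.2 ht.2) ht.1
      (sub_add_cancel 1 t)
    convert h using 1
    module
  have hbound : ∀ t ∈ Set.Ico (0 : ℝ) 1,
      ⟪gradient g (x₀ + t • (x - x₀)), x - x₀⟫ ≤ ⟪α, x - x₀⟫ := by
    intro t ht
    have hpos : 0 < 1 - t := sub_pos.2 ht.2
    have hdiff : DifferentiableAt ℝ g (x₀ + t • (x - x₀)) :=
      (hLeg.1.differentiableOn (by norm_num)).differentiableAt (hUo.mem_nhds (hmem t ht))
    have hline : HasDerivAt (fun s : ℝ => x₀ + s • (x - x₀)) (x - x₀) t := by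
      simpa using ((hasDerivAt_id t).smul_const (x - x₀)).const_add x₀
    have hderiv : HasDerivAt (fun s : ℝ => g (x₀ + s • (x - x₀)))
        ⟪gradient g (x₀ + t • (x - x₀)), x - x₀⟫ t := by
      have h := hdiff.hasGradientAt.hasFDerivAt.comp_hasDerivAt t hline
      rwa [InnerProductSpace.toDual_apply_apply] at h
    have hchord := deriv_mul_le_of_le_chord (b := b) ht.2 hderiv fun s hs => by
      have h1 : (x₀ + t • (x - x₀), g (x₀ + t • (x - x₀))) ∈ epigraph f :=
        (hg _ (hmem t ht)).le
      have h2 : (x, b) ∈ epigraph f := hb.le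
      have h3 := hconv h1 h2 (a := (1 - s) / (1 - t)) (b := (s - t) / (1 - t))
        (div_nonneg (sub_nonneg.2 hs.2.le) hpos.le)
        (div_nonneg (sub_nonneg.2 hs.1.le) hpos.le) (by field_simp; ring)
      have h4 : ((1 - s) / (1 - t)) • (x₀ + t • (x - x₀)) + ((s - t) / (1 - t)) • x
          = x₀ + s • (x - x₀) := by
        match_scalars <;> field_simp <;> ring
      simp only [epigraph, Set.mem_ofPred_eq, Prod.smul_mk, Prod.mk_add_mk, h4,
        hg _ (hmem s ⟨ht.1.trans hs.1.le, hs.2⟩), EReal.coe_le_coe_iff, smul_eq_mul] at h3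
      calc (1 - t) * g (x₀ + s • (x - x₀)) ≤ (1 - t) * _ :=
            mul_le_mul_of_nonneg_left h3 hpos.le
        _ = _ := by field_simp
    have hsub := hα' (x₀ + t • (x - x₀))
    have hvec : x₀ + t • (x - x₀) - x = -((1 - t) • (x - x₀)) := by module
    rw [hb, hg _ (hmem t ht), ← EReal.coe_add, EReal.coe_le_coe_iff, hvec, inner_neg_right,
      real_inner_smul_right] at hsub
    exact le_of_mul_le_mul_left (by linarith) hpos
  obtain ⟨t, hlarge, ht⟩ := (((hLeg.2.2 x₀ hx₀ x hxU).eventually_gt_atTop ⟪α, x - x₀⟫).and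
    (Ico_mem_nhdsLT zero_lt_one)).exists
  exact (hbound t ht).not_gt hlarge
end

section
/- Let μ be a nonzero positive admissible Borel measure on ℝⁿ such that the closed convex hull C_μ of the support of μ has nonempty interior. Then for every x in the interior of D_{L(μ)}, the second differential d²(log L(μ))(x) is a positive definite bilinear form on ℝⁿ, i.e. d²(log L(μ))(x)(y,y) > 0 for every y ≠ 0. -/
open scoped RealInnerProductSpace ENNReal
open MeasureTheory

/-- The Laplace transform `L(μ)(x) = ∫ e^{⟨α,x⟩} dμ(α) ∈ (0,+∞]` of a positive Borel
measure `μ` on `ℝⁿ`. -/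
noncomputable def laplaceT {n : ℕ} (μ : Measure (EuclideanSpace ℝ (Fin n)))
    (x : EuclideanSpace ℝ (Fin n)) : ℝ≥0∞ :=
  ∫⁻ α, ENNReal.ofReal (Real.exp ⟪α, x⟫) ∂μ

/-- The support of a measure: points all of whose open neighbourhoods have positive measure. -/
def measSupport {n : ℕ} (μ : Measure (EuclideanSpace ℝ (Fin n))) :
    Set (EuclideanSpace ℝ (Fin n)) :=
  {x | ∀ V : Set (EuclideanSpace ℝ (Fin n)), x ∈ V → IsOpen V → 0 < μ V}

section

variable {n : ℕ} {μ : Measure (EuclideanSpace ℝ (Fin n))}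

lemma integrable_exp_inner_of_laplaceT_ne_top {x : EuclideanSpace ℝ (Fin n)}
    (hx : laplaceT μ x ≠ ⊤) : Integrable (fun α => Real.exp ⟪α, x⟫) μ := by
  refine ⟨by fun_prop, ?_⟩
  rw [hasFiniteIntegral_iff_ofReal (Filter.Eventually.of_forall fun _ => (Real.exp_pos _).le)]
  exact lt_top_iff_ne_top.2 hx

lemma laplaceT_toReal (x : EuclideanSpace ℝ (Fin n)) :
    (laplaceT μ x).toReal = ∫ α, Real.exp ⟪α, x⟫ ∂μ :=
  (integral_eq_lintegral_of_nonneg_ae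
    (Filter.Eventually.of_forall fun _ => (Real.exp_pos _).le) (by fun_prop)).symm

lemma exists_norm_le_card_mul_abs [NeZero n] (α : EuclideanSpace ℝ (Fin n)) :
    ∃ i, ‖α‖ ≤ n * |α i| := by
  obtain ⟨i, -, hi⟩ := Finset.exists_max_image Finset.univ (fun i => |α i|) Finset.univ_nonempty
  refine ⟨i, ?_⟩
  have hn : (1 : ℝ) ≤ n := by exact_mod_cast NeZero.one_le
  rw [EuclideanSpace.norm_eq]
  refine Real.sqrt_le_iff.2 ⟨by positivity, ?_⟩
  calc ∑ j, ‖α j‖ ^ 2 ≤ ∑ _j : Fin n, |α i| ^ 2 := by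
        refine Finset.sum_le_sum fun j hj => ?_
        rw [Real.norm_eq_abs]
        exact pow_le_pow_left₀ (abs_nonneg _) (hi j hj) 2
    _ = n * |α i| ^ 2 := by simp
    _ ≤ (n * |α i|) ^ 2 := by
        rw [mul_pow]
        gcongr
        nlinarith

lemma exists_integrable_exp_inner_add_norm [NeZero n] {x : EuclideanSpace ℝ (Fin n)}
    (hx : x ∈ interior {x | laplaceT μ x ≠ ⊤}) :
    ∃ ε > 0, Integrable (fun α => Real.exp (⟪α, x⟫ + ε * ‖α‖)) μ := by
  obtain ⟨r, hr, hball⟩ := Metric.isOpen_iff.1 isOpen_interior x hx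
  have hn : (0 : ℝ) < n := by exact_mod_cast NeZero.pos n
  have hexp (c : ℝ) (hc : |c| < r) (i : Fin n) :
      Integrable (fun α => Real.exp (⟪α, x⟫ + c * α i)) μ := by
    have h : x + EuclideanSpace.single i c ∈ {x | laplaceT μ x ≠ ⊤} :=
      interior_subset (hball (by simpa using hc))
    refine (integrable_exp_inner_of_laplaceT_ne_top h).congr
      (Filter.Eventually.of_forall fun α => ?_)
    simp [inner_add_right, EuclideanSpace.inner_single_right]
  have hr2 : |r / 2| < r := by rw [abs_of_pos (by positivity)]; linarith
  have hr2' : |-(r / 2)| < r := by rwa [abs_neg]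
  refine ⟨r / 2 / n, by positivity, Integrable.mono'
    (integrable_finsetSum Finset.univ
      fun i _ => (hexp (r / 2) hr2 i).add (hexp (-(r / 2)) hr2' i))
    (by fun_prop) (Filter.Eventually.of_forall fun α => ?_)⟩
  obtain ⟨i, hi⟩ := exists_norm_le_card_mul_abs α
  have hle : r / 2 / n * ‖α‖ ≤ r / 2 * |α i| := by
    calc r / 2 / n * ‖α‖ ≤ r / 2 / n * (n * |α i|) := by gcongr
      _ = r / 2 * |α i| := by field_simp
  rw [Real.norm_eq_abs, Real.abs_exp]
  refine le_trans ?_ (Finset.single_le_sum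
    (f := fun i => Real.exp (⟪α, x⟫ + r / 2 * α i) + Real.exp (⟪α, x⟫ + -(r / 2) * α i))
    (fun j _ => by positivity) (Finset.mem_univ i))
  rcases abs_cases (α i) with ⟨h, -⟩ | ⟨h, -⟩ <;> rw [h] at hle
  · refine (Real.exp_le_exp.2 ?_).trans (le_add_of_nonneg_right (Real.exp_pos _).le)
    linarith
  · refine (Real.exp_le_exp.2 ?_).trans (le_add_of_nonneg_left (Real.exp_pos _).le)
    linarith

lemma exists_integrable_exp_inner_add_norm_mul_norm_pow [NeZero n]
    {x : EuclideanSpace ℝ (Fin n)} (hx : x ∈ interior {x | laplaceT μ x ≠ ⊤}) :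
    ∃ ε > 0, ∀ k : ℕ,
      Integrable (fun α => Real.exp (⟪α, x⟫ + ε * ‖α‖) * ‖α‖ ^ k) μ := by
  obtain ⟨ε, hε, hexp⟩ := exists_integrable_exp_inner_add_norm hx
  refine ⟨ε / 2, by positivity, fun k => ?_⟩
  refine (hexp.mul_const (k.factorial / (ε / 2) ^ k)).mono' (by fun_prop)
    (Filter.Eventually.of_forall fun α => ?_)
  have h := Real.pow_div_factorial_le_exp (ε / 2 * ‖α‖) (by positivity) k
  rw [Real.norm_of_nonneg (by positivity)]
  calc Real.exp (⟪α, x⟫ + ε / 2 * ‖α‖) * ‖α‖ ^ k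
      = Real.exp (⟪α, x⟫ + ε / 2 * ‖α‖) * ((ε / 2 * ‖α‖) ^ k / k.factorial)
          * (k.factorial / (ε / 2) ^ k) := by
        rw [mul_pow]; field_simp
    _ ≤ Real.exp (⟪α, x⟫ + ε / 2 * ‖α‖) * Real.exp (ε / 2 * ‖α‖)
          * (k.factorial / (ε / 2) ^ k) := by gcongr
    _ = Real.exp (⟪α, x⟫ + ε * ‖α‖) * (k.factorial / (ε / 2) ^ k) := by
        rw [← Real.exp_add]; ring_nf

variable {V : Type*} [NormedAddCommGroup V] [NormedSpace ℝ V]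

lemma integrable_exp_inner_smul [NeZero n] {x : EuclideanSpace ℝ (Fin n)}
    (hx : x ∈ interior {x | laplaceT μ x ≠ ⊤}) {k : ℕ} {v : EuclideanSpace ℝ (Fin n) → V}
    (hv : Continuous v) (hvk : ∀ α, ‖v α‖ ≤ ‖α‖ ^ k) :
    Integrable (fun α => Real.exp ⟪α, x⟫ • v α) μ := by
  obtain ⟨ε, hε, hexp⟩ := exists_integrable_exp_inner_add_norm_mul_norm_pow hx
  have hc : Continuous fun α : EuclideanSpace ℝ (Fin n) => Real.exp ⟪α, x⟫ • v α := by fun_prop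
  refine (hexp k).mono' hc.aestronglyMeasurable (Filter.Eventually.of_forall fun α => ?_)
  rw [norm_smul, Real.norm_eq_abs, Real.abs_exp]
  gcongr
  · exact le_add_of_nonneg_right (by positivity)
  · exact hvk α

lemma hasFDerivAt_integral_exp_inner_smul [NeZero n] {x : EuclideanSpace ℝ (Fin n)}
    (hx : x ∈ interior {x | laplaceT μ x ≠ ⊤}) {k : ℕ} {v : EuclideanSpace ℝ (Fin n) → V}
    (hv : Continuous v) (hvk : ∀ α, ‖v α‖ ≤ ‖α‖ ^ k) :
    HasFDerivAt (fun w => ∫ α, Real.exp ⟪α, w⟫ • v α ∂μ)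
      (∫ α, Real.exp ⟪α, x⟫ • (innerSL ℝ α).smulRight (v α) ∂μ) x := by
  obtain ⟨ε, hε, hexp⟩ := exists_integrable_exp_inner_add_norm_mul_norm_pow hx
  have hc (w : EuclideanSpace ℝ (Fin n)) :
      Continuous fun α : EuclideanSpace ℝ (Fin n) => Real.exp ⟪α, w⟫ • v α := by fun_prop
  have hc' : Continuous fun α : EuclideanSpace ℝ (Fin n) =>
      Real.exp ⟪α, x⟫ • (innerSL ℝ α).smulRight (v α) := by
    fun_prop
  refine hasFDerivAt_integral_of_dominated_of_fderiv_le (Metric.ball_mem_nhds x hε)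
    (F' := fun w α => Real.exp ⟪α, w⟫ • (innerSL ℝ α).smulRight (v α))
    (Filter.Eventually.of_forall fun w => (hc w).aestronglyMeasurable)
    (integrable_exp_inner_smul hx hv hvk) hc'.aestronglyMeasurable
    (Filter.Eventually.of_forall fun α w hw => ?_) (hexp (k + 1))
    (Filter.Eventually.of_forall fun α w _ => ?_)
  · have hle : ⟪α, w⟫ ≤ ⟪α, x⟫ + ε * ‖α‖ := by
      have h1 : ⟪α, w⟫ = ⟪α, x⟫ + ⟪α, w - x⟫ := by rw [inner_sub_right]; ring
      have h2 := real_inner_le_norm α (w - x)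
      have h3 : ‖w - x‖ ≤ ε := (mem_ball_iff_norm.1 hw).le
      nlinarith [norm_nonneg α]
    rw [norm_smul, Real.norm_eq_abs, Real.abs_exp, ContinuousLinearMap.norm_smulRight_apply,
      innerSL_apply_norm, pow_succ']
    gcongr
    exact hvk α
  · have h := (((innerSL ℝ α).hasFDerivAt (x := w)).exp).smul_const (v α)
    refine h.congr_fderiv ?_
    ext y
    simp [mul_smul]

lemma hasFDerivAt_laplaceT_toReal [NeZero n] {x : EuclideanSpace ℝ (Fin n)}
    (hx : x ∈ interior {x | laplaceT μ x ≠ ⊤}) :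
    HasFDerivAt (fun w => (laplaceT μ w).toReal)
      (∫ α, Real.exp ⟪α, x⟫ • innerSL ℝ α ∂μ) x := by
  have h := hasFDerivAt_integral_exp_inner_smul (k := 0) hx (v := fun _ => (1 : ℝ))
    continuous_const (by simp)
  have hone (α : EuclideanSpace ℝ (Fin n)) :
      (innerSL ℝ α).smulRight (1 : ℝ) = innerSL ℝ α := by ext; simp
  simp only [smul_eq_mul, mul_one, hone] at h
  simpa only [laplaceT_toReal] using h

lemma laplaceT_toReal_pos (hμ : μ ≠ 0) {x : EuclideanSpace ℝ (Fin n)}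
    (hx : laplaceT μ x ≠ ⊤) : 0 < (laplaceT μ x).toReal := by
  have : NeZero μ := ⟨hμ⟩
  rw [laplaceT_toReal]
  exact integral_exp_pos (integrable_exp_inner_of_laplaceT_ne_top hx)

lemma not_ae_inner_eq_const (hCμ : (interior (closure (convexHull ℝ (measSupport μ)))).Nonempty)
    {y : EuclideanSpace ℝ (Fin n)} (hy : y ≠ 0) (m : ℝ) : ¬ ∀ᵐ α ∂μ, ⟪α, y⟫ = m := by
  intro h
  have hcont : Continuous fun α : EuclideanSpace ℝ (Fin n) => ⟪α, y⟫ := by fun_prop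
  have hclosed : IsClosed {α : EuclideanSpace ℝ (Fin n) | ⟪α, y⟫ = m} :=
    isClosed_eq hcont continuous_const
  have hsupp : measSupport μ ⊆ {α | ⟪α, y⟫ = m} := by
    intro α hα
    by_contra hne
    exact (hα _ hne hclosed.isOpen_compl).ne' h
  have hconv : Convex ℝ {α : EuclideanSpace ℝ (Fin n) | ⟪α, y⟫ = m} := by
    simp_rw [real_inner_comm y]
    exact convex_hyperplane (innerSL ℝ y).toLinearMap.isLinear m
  obtain ⟨z, hz⟩ := hCμ
  have hz := interior_mono (closure_minimal (convexHull_min hsupp hconv) hclosed) hz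
  obtain ⟨r, hr, hball⟩ := Metric.mem_nhds_iff.1 (mem_interior_iff_mem_nhds.1 hz)
  have hyn : 0 < ‖y‖ := norm_pos_iff.2 hy
  have h1 : ⟪z, y⟫ = m := hball (Metric.mem_ball_self hr)
  have h2 : ⟪z + (r / 2 / ‖y‖) • y, y⟫ = m := by
    refine hball ?_
    rw [mem_ball_iff_norm, add_sub_cancel_left, norm_smul, Real.norm_of_nonneg (by positivity),
      div_mul_cancel₀ _ hyn.ne']
    linarith
  rw [inner_add_left, h1, real_inner_smul_left, real_inner_self_eq_norm_sq] at h2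
  have : 0 < r / 2 / ‖y‖ * ‖y‖ ^ 2 := by positivity
  linarith

end

/-- Let `μ` be a nonzero positive admissible Borel measure on `ℝⁿ` such
that the closed convex hull `C_μ` of its support has nonempty interior.  Then for every
`x ∈ Int(D_{L(μ)})` the second differential `d²(log L(μ))(x)` is positive definite:
`d²(log L(μ))(x)(y,y) > 0` for every `y ≠ 0`. -/
theorem laplace_log_hessian_posDef
    {n : ℕ} (μ : Measure (EuclideanSpace ℝ (Fin n)))
    (hμ : μ ≠ 0)
    (hadm : {x | laplaceT μ x ≠ ⊤}.Nonempty)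
    (hCμ : (interior (closure (convexHull ℝ (measSupport μ)))).Nonempty) :
    ∀ x ∈ interior {x | laplaceT μ x ≠ ⊤},
      ∀ y : EuclideanSpace ℝ (Fin n), y ≠ 0 →
        0 < iteratedFDerivWithin ℝ 2 (fun x => Real.log (laplaceT μ x).toReal)
              (interior {x | laplaceT μ x ≠ ⊤}) x ![y, y] := by
  intro x hx y hy
  have : NeZero n := ⟨by rintro rfl; exact hy (Subsingleton.elim _ _)⟩
  set U := interior {x | laplaceT μ x ≠ ⊤}
  let G : EuclideanSpace ℝ (Fin n) → EuclideanSpace ℝ (Fin n) →L[ℝ] ℝ :=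
    fun w => ∫ α, Real.exp ⟪α, w⟫ • innerSL ℝ α ∂μ
  let F : EuclideanSpace ℝ (Fin n) → ℝ := fun w => (laplaceT μ w).toReal
  have hF (w) (hw : w ∈ U) : HasFDerivAt F (G w) w := hasFDerivAt_laplaceT_toReal hw
  have hFpos (w) (hw : w ∈ U) : 0 < F w := laplaceT_toReal_pos hμ (interior_subset hw)
  have hG := hasFDerivAt_integral_exp_inner_smul (μ := μ) (k := 1) hx
    (v := fun α => innerSL ℝ α) (by fun_prop) (by simp)
  have hfderiv : fderiv ℝ (fun w => Real.log (F w)) =ᶠ[nhds x] fun w => (F w)⁻¹ • G w := by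
    filter_upwards [isOpen_interior.mem_nhds hx] with w hw
    exact ((hF w hw).log (hFpos w hw).ne').fderiv
  have hFx := hFpos x hx
  have hinv := (hasDerivAt_inv hFx.ne').comp_hasFDerivAt x (hF x hx)
  have hsnd := (hinv.smul hG).congr_of_eventuallyEq hfderiv
  have hint1 := integrable_exp_inner_smul (μ := μ) (k := 1) hx
    (v := fun α => innerSL ℝ α) (by fun_prop) (by simp)
  have hint2 := integrable_exp_inner_smul (μ := μ) (k := 2) hx
    (v := fun α => (innerSL ℝ α).smulRight (innerSL ℝ α)) (by fun_prop)
    (fun α => by rw [ContinuousLinearMap.norm_smulRight_apply, innerSL_apply_norm, sq])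
  have hGy : G x y = ∫ α, Real.exp ⟪α, x⟫ * ⟪α, y⟫ ∂μ := by
    rw [ContinuousLinearMap.integral_apply hint1]; simp
  have hHy : (∫ α, Real.exp ⟪α, x⟫ • (innerSL ℝ α).smulRight (innerSL ℝ α) ∂μ) y y
      = ∫ α, Real.exp ⟪α, x⟫ * ⟪α, y⟫ ^ 2 ∂μ := by
    rw [ContinuousLinearMap.integral_apply hint2,
      ContinuousLinearMap.integral_apply (hint2.apply_continuousLinearMap y)]
    simp [sq]
  have hi0 := integrable_exp_inner_of_laplaceT_ne_top (interior_subset hx)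
  have hi1 : Integrable (fun α => Real.exp ⟪α, x⟫ * ⟪α, y⟫) μ := by
    simpa using hint1.apply_continuousLinearMap y
  have hi2 : Integrable (fun α => Real.exp ⟪α, x⟫ * ⟪α, y⟫ ^ 2) μ := by
    simpa [sq] using (hint2.apply_continuousLinearMap y).apply_continuousLinearMap y
  set m := G x y / F x with hm
  have hexpand (α : EuclideanSpace ℝ (Fin n)) : Real.exp ⟪α, x⟫ * (⟪α, y⟫ - m) ^ 2 =
      Real.exp ⟪α, x⟫ * ⟪α, y⟫ ^ 2 - 2 * m * (Real.exp ⟪α, x⟫ * ⟪α, y⟫)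
        + m ^ 2 * Real.exp ⟪α, x⟫ := by ring
  have hi3 : Integrable (fun α => Real.exp ⟪α, x⟫ * (⟪α, y⟫ - m) ^ 2) μ := by
    simp only [hexpand]
    exact (hi2.sub (hi1.const_mul _)).add (hi0.const_mul _)
  have hvar : ∫ α, Real.exp ⟪α, x⟫ * (⟪α, y⟫ - m) ^ 2 ∂μ
      = ∫ α, Real.exp ⟪α, x⟫ * ⟪α, y⟫ ^ 2 ∂μ - 2 * m * G x y + m ^ 2 * F x := by
    simp only [hexpand]
    rw [integral_add (by exact hi2.sub (hi1.const_mul _)) (hi0.const_mul _),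
      integral_sub hi2 (hi1.const_mul _), integral_const_mul, integral_const_mul, hGy,
      ← laplaceT_toReal]
  have hnonneg : 0 ≤ fun α => Real.exp ⟪α, x⟫ * (⟪α, y⟫ - m) ^ 2 := fun α => by positivity
  have hpos : 0 < ∫ α, Real.exp ⟪α, x⟫ * (⟪α, y⟫ - m) ^ 2 ∂μ := by
    refine (integral_nonneg hnonneg).lt_of_ne' fun h0 => not_ae_inner_eq_const hCμ hy m ?_
    filter_upwards [(integral_eq_zero_iff_of_nonneg hnonneg hi3).1 h0] with α hα
    simpa [sub_eq_zero, (Real.exp_pos _).ne'] using hα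
  rw [iteratedFDerivWithin_of_isOpen 2 isOpen_interior hx, iteratedFDeriv_two_apply]
  change 0 < fderiv ℝ (fderiv ℝ fun w => Real.log (F w)) x y y
  rw [hsnd.fderiv]
  have hval : ((F x)⁻¹ * (∫ α, Real.exp ⟪α, x⟫ * ⟪α, y⟫ ^ 2 ∂μ)
      + -((F x ^ 2)⁻¹ * G x y * G x y))
      = (F x)⁻¹ * ∫ α, Real.exp ⟪α, x⟫ * (⟪α, y⟫ - m) ^ 2 ∂μ := by
    rw [hvar, hm]
    field_simp
    ring
  have hfin := mul_pos (inv_pos.2 hFx) hpos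
  rw [← hval, ← hHy] at hfin
  refine hfin.trans_eq ?_
  simp [G]
end

section
/- For every nonempty open convex subset C ⊆ ℝⁿ there exists a C² function f : ℝⁿ → ℝ with d²f(x) positive definite for every x ∈ ℝⁿ (hence a C²-Legendre function on ℝⁿ) such that ∇f(ℝⁿ) = C. -/
open MeasureTheory Set Filter Topology
open scoped RealInnerProductSpace ENNReal

namespace LegendreGradientRange

section Transform

variable {E F : Type*} [NormedAddCommGroup E] [InnerProductSpace ℝ E]
  [NormedAddCommGroup F] [NormedSpace ℝ F]

theorem exists_inner_ne {C : Set E} (hC : IsOpen C) (hne : C.Nonempty) {v : E} (hv : v ≠ 0)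
    (a : ℝ) : ∃ y ∈ C, ⟪v, y⟫ ≠ a := by
  obtain ⟨y, hy⟩ := hne
  by_contra! H
  have h1 : ∀ᶠ t : ℝ in 𝓝[≠] 0, y + t • v ∈ C := by
    refine (ContinuousAt.eventually_mem (f := fun t : ℝ => y + t • v) (x := 0)
      (by fun_prop) ?_).filter_mono nhdsWithin_le_nhds
    simpa using hC.mem_nhds hy
  obtain ⟨t, ht, ht0⟩ := (h1.and self_mem_nhdsWithin).exists
  have h2 := H _ ht
  rw [inner_add_right, H y hy, inner_smul_right] at h2
  have : t * ⟪v, v⟫ = 0 := by linarith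
  rcases mul_eq_zero.1 this with h | h
  · exact ht0 h
  · exact hv (inner_self_eq_zero.1 h)

/-- The integrand of the derivative of the Laplace transform of `h`, as an operator. -/
noncomputable def innerMul (h : E → F) (y : E) : E →L[ℝ] F :=
  (innerSL ℝ y).smulRight (h y)

theorem norm_innerMul_le (h : E → F) (y : E) : ‖innerMul h y‖ ≤ Real.exp ‖y‖ * ‖h y‖ := by
  rw [innerMul, ContinuousLinearMap.norm_smulRight_apply, innerSL_apply_norm]
  gcongr
  linarith [Real.add_one_le_exp ‖y‖]

variable [MeasurableSpace E] {μ : Measure E} {h : E → F}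

/-- `h` is continuous and integrable against every exponential weight `exp (R * ‖y‖)`. -/
def ExpIntegrable (μ : Measure E) (h : E → F) : Prop :=
  Continuous h ∧ ∀ R : ℝ, Integrable (fun y => Real.exp (R * ‖y‖) * ‖h y‖) μ

/-- The vector-valued Laplace transform `x ↦ ∫ exp ⟪x, y⟫ • h y ∂μ`. -/
noncomputable def laplace (μ : Measure E) (h : E → F) (x : E) : F :=
  ∫ y, Real.exp ⟪x, y⟫ • h y ∂μ

variable [BorelSpace E]

theorem ExpIntegrable.innerMul (hh : ExpIntegrable μ h) : ExpIntegrable μ (innerMul h) := by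
  have hc : Continuous (LegendreGradientRange.innerMul h) := by
    have := hh.1
    unfold LegendreGradientRange.innerMul
    fun_prop
  refine ⟨hc, fun R => (hh.2 (R + 1)).mono' ?_ (ae_of_all _ fun y => ?_)⟩
  · exact Continuous.aestronglyMeasurable (by fun_prop)
  · rw [norm_mul, norm_norm, Real.norm_of_nonneg (Real.exp_pos _).le]
    calc Real.exp (R * ‖y‖) * ‖LegendreGradientRange.innerMul h y‖
        ≤ Real.exp (R * ‖y‖) * (Real.exp ‖y‖ * ‖h y‖) := by
          gcongr; exact norm_innerMul_le h y
      _ = Real.exp ((R + 1) * ‖y‖) * ‖h y‖ := by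
          rw [← mul_assoc, ← Real.exp_add]; ring_nf

theorem ExpIntegrable.inner_smul (hh : ExpIntegrable μ h) (v : E) :
    ExpIntegrable μ (fun y => ⟪v, y⟫ • h y) := by
  have hc := hh.1
  refine ⟨by fun_prop, fun R => ((hh.innerMul.2 R).const_mul ‖v‖).mono'
    (Continuous.aestronglyMeasurable (by fun_prop)) (ae_of_all _ fun y => ?_)⟩
  rw [norm_mul, norm_norm, Real.norm_of_nonneg (Real.exp_pos _).le]
  have := (LegendreGradientRange.innerMul h y).le_opNorm v
  simp only [LegendreGradientRange.innerMul, ContinuousLinearMap.smulRight_apply,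
    innerSL_apply_apply] at this ⊢
  rw [real_inner_comm v y] at this
  calc _ ≤ _ := mul_le_mul_of_nonneg_left this (Real.exp_pos _).le
    _ = _ := by ring

variable [FiniteDimensional ℝ E]

theorem ExpIntegrable.integrable (hh : ExpIntegrable μ h) (x : E) :
    Integrable (fun y => Real.exp ⟪x, y⟫ • h y) μ := by
  have := hh.1
  refine (hh.2 ‖x‖).mono' (Continuous.aestronglyMeasurable (by fun_prop))
    (ae_of_all _ fun y => ?_)
  rw [norm_smul, Real.norm_of_nonneg (Real.exp_pos _).le]
  gcongr
  exact real_inner_le_norm x y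

theorem hasFDerivAt_laplace (hh : ExpIntegrable μ h) (x : E) :
    HasFDerivAt (laplace μ h) (laplace μ (innerMul h) x) x := by
  have hc := hh.1
  refine hasFDerivAt_integral_of_dominated_of_fderiv_le
    (F' := fun x y => Real.exp ⟪x, y⟫ • innerMul h y)
    (bound := fun y => Real.exp ((‖x‖ + 1) * ‖y‖) * ‖innerMul h y‖)
    (Metric.ball_mem_nhds x one_pos)
    (Eventually.of_forall fun z => (hh.integrable z).aestronglyMeasurable) (hh.integrable x)
    (hh.innerMul.integrable x).aestronglyMeasurable ?_ (hh.innerMul.2 _) ?_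
  · refine ae_of_all _ fun y z hz => ?_
    rw [norm_smul, Real.norm_of_nonneg (Real.exp_pos _).le]
    have hz' : ‖z‖ ≤ ‖x‖ + 1 := by
      have h1 := norm_le_norm_add_norm_sub' z x
      rw [Metric.mem_ball, dist_eq_norm] at hz
      linarith
    gcongr
    exact (real_inner_le_norm z y).trans (by gcongr)
  · refine ae_of_all _ fun y z _ => ?_
    have h1 : HasFDerivAt (fun z : E => ⟪z, y⟫) (innerSL ℝ y) z := by
      simpa [real_inner_comm] using (innerSL ℝ y).hasFDerivAt (x := z)
    convert h1.exp.smul_const (h y) using 1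
    ext v
    simp [innerMul, smul_smul]

theorem contDiff_laplace (hh : ExpIntegrable μ h) : ContDiff ℝ 2 (laplace μ h) :=
  contDiff_succ_iff_hasFDerivAt (n := 1).2 ⟨_, contDiff_one_iff_hasFDerivAt.2
    ⟨_, continuous_iff_continuousAt.2 fun x =>
        (hasFDerivAt_laplace hh.innerMul.innerMul x).continuousAt,
      hasFDerivAt_laplace hh.innerMul⟩, hasFDerivAt_laplace hh⟩

theorem laplace_innerMul_apply (hh : ExpIntegrable μ h) (x v : E) :
    laplace μ (innerMul h) x v = laplace μ (fun y => ⟪v, y⟫ • h y) x := by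
  rw [laplace, ContinuousLinearMap.integral_apply (hh.innerMul.integrable x)]
  simp [laplace, innerMul, real_inner_comm]

end Transform

section Gaussian

variable {E : Type*} [NormedAddCommGroup E] [InnerProductSpace ℝ E] [FiniteDimensional ℝ E]
  [MeasurableSpace E] [BorelSpace E] {C : Set E}

/-- The measure with density `exp (-‖y‖ ^ 2)` on `C`. -/
noncomputable def gaussianOn (C : Set E) : Measure E :=
  (volume.restrict C).withDensity fun y => ENNReal.ofReal (Real.exp (-‖y‖ ^ 2))

theorem expIntegrable_one (C : Set E) : ExpIntegrable (gaussianOn C) (fun _ => (1 : ℝ)) := by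
  refine ⟨continuous_const, fun R => ?_⟩
  rw [gaussianOn, integrable_withDensity_iff (by fun_prop) (by simp)]
  refine Integrable.restrict ?_
  have hg : Integrable (fun y : E => Real.exp (-(1 / 2 : ℝ) * ‖y‖ ^ 2)) := by
    refine Integrable.of_integral_ne_zero ?_
    rw [GaussianFourier.integral_rexp_neg_mul_sq_norm (by norm_num)]
    positivity
  refine (hg.const_mul (Real.exp (R ^ 2 / 2))).mono'
    (Continuous.aestronglyMeasurable ?_) (ae_of_all _ fun y => ?_)
  · simp only [ENNReal.toReal_ofReal (Real.exp_pos _).le]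
    fun_prop
  · rw [ENNReal.toReal_ofReal (Real.exp_pos _).le, Real.norm_of_nonneg (by positivity),
      norm_one, mul_one, ← Real.exp_add, ← Real.exp_add, Real.exp_le_exp]
    nlinarith [sq_nonneg (R - ‖y‖)]

theorem ae_mem_gaussianOn (hC : IsOpen C) : ∀ᵐ y ∂gaussianOn C, y ∈ C :=
  (withDensity_absolutelyContinuous _ _).ae_le (ae_restrict_mem hC.measurableSet)

theorem gaussianOn_pos (hC : IsOpen C) {U : Set E} (hU : IsOpen U) (hUC : (U ∩ C).Nonempty) :
    0 < gaussianOn C U := by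
  refine pos_iff_ne_zero.2 fun h0 => ?_
  have h1 : volume.restrict C ≪ gaussianOn C :=
    withDensity_absolutelyContinuous' (by fun_prop)
      (ae_of_all _ fun y => by simp [Real.exp_pos])
  have h2 := h1 h0
  rw [Measure.restrict_apply hU.measurableSet] at h2
  exact ((hU.inter hC).measure_pos volume hUC).ne' h2

theorem integral_gaussianOn_pos (hC : IsOpen C) {g : E → ℝ} (hg : Continuous g)
    (hi : Integrable g (gaussianOn C)) (h0 : ∀ y ∈ C, 0 ≤ g y) (h1 : ∃ y ∈ C, 0 < g y) :
    0 < ∫ y, g y ∂gaussianOn C := by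
  rw [integral_pos_iff_support_of_nonneg_ae ((ae_mem_gaussianOn hC).mono h0) hi]
  obtain ⟨y, hy, hgy⟩ := h1
  exact gaussianOn_pos hC (hg.isOpen_support) ⟨y, hgy.ne', hy⟩

instance (C : Set E) : IsFiniteMeasure (gaussianOn C) := by
  have h : Integrable (fun _ : E => (1 : ℝ)) (gaussianOn C) := by
    simpa using (expIntegrable_one C).integrable 0
  simpa [integrable_const_iff] using h

/-- The balls of radius `s` inside `ball y₀ r ⊆ C` have mass bounded below. -/
theorem exists_le_gaussianOn_ball {y₀ : E} {s r : ℝ} (hs : 0 < s) (hr : Metric.ball y₀ r ⊆ C) :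
    ∃ c > 0, ∀ z, Metric.ball z s ⊆ Metric.ball y₀ r →
      c ≤ (gaussianOn C).real (Metric.ball z s) := by
  refine ⟨Real.exp (-(‖y₀‖ + r) ^ 2) * (volume : Measure E).real (Metric.ball 0 s), ?_,
    fun z hz => ?_⟩
  · refine mul_pos (Real.exp_pos _) (ENNReal.toReal_pos ?_ measure_ball_lt_top.ne)
    exact (Metric.measure_ball_pos _ _ hs).ne'
  · have key : ENNReal.ofReal (Real.exp (-(‖y₀‖ + r) ^ 2)) * volume (Metric.ball z s)
        ≤ gaussianOn C (Metric.ball z s) := by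
      rw [gaussianOn, withDensity_apply _ measurableSet_ball,
        Measure.restrict_restrict measurableSet_ball,
        inter_eq_left.2 (hz.trans hr), ← setLIntegral_const]
      refine setLIntegral_mono (by fun_prop) fun y hy => ?_
      have hy' : ‖y‖ ≤ ‖y₀‖ + r := by
        have h1 := norm_le_norm_add_norm_sub' y y₀
        have h2 := hz hy
        rw [Metric.mem_ball, dist_eq_norm] at h2
        linarith
      gcongr
    have h2 := ENNReal.toReal_mono (measure_ne_top _ _) key
    rwa [ENNReal.toReal_mul, ENNReal.toReal_ofReal (Real.exp_pos _).le,
      ← measureReal_def, ← measureReal_def, Measure.addHaar_real_ball_center] at h2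

/-- The cumulant generating function of `gaussianOn C`. -/
noncomputable def cumulant (C : Set E) (x : E) : ℝ :=
  Real.log (laplace (gaussianOn C) (fun _ => (1 : ℝ)) x)

theorem laplace_one_pos (hC : IsOpen C) (hne : C.Nonempty) (x : E) :
    0 < laplace (gaussianOn C) (fun _ => (1 : ℝ)) x :=
  integral_gaussianOn_pos hC (by fun_prop) ((expIntegrable_one C).integrable x)
    (fun y _ => by positivity) (hne.imp fun y hy => ⟨hy, by positivity⟩)

theorem contDiff_cumulant (hC : IsOpen C) (hne : C.Nonempty) : ContDiff ℝ 2 (cumulant C) :=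
  (contDiff_laplace (expIntegrable_one C)).log fun x => (laplace_one_pos hC hne x).ne'

theorem hasFDerivAt_cumulant (hC : IsOpen C) (hne : C.Nonempty) (x : E) :
    HasFDerivAt (cumulant C) ((laplace (gaussianOn C) (fun _ => (1 : ℝ)) x)⁻¹ •
      laplace (gaussianOn C) (innerMul fun _ => (1 : ℝ)) x) x :=
  (hasFDerivAt_laplace (expIntegrable_one C) x).log (laplace_one_pos hC hne x).ne'

theorem iteratedFDeriv_two_cumulant_pos (hC : IsOpen C) (hne : C.Nonempty) (x : E) {v : E}
    (hv : v ≠ 0) : 0 < iteratedFDeriv ℝ 2 (cumulant C) x ![v, v] := by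
  have h0 := expIntegrable_one C
  set L := laplace (gaussianOn C) (fun _ => (1 : ℝ)) with hL
  set L₁ := laplace (gaussianOn C) (innerMul fun _ => (1 : ℝ)) with hL₁
  set L₂ := laplace (gaussianOn C) (innerMul (innerMul fun _ => (1 : ℝ))) with hL₂
  have hLpos : 0 < L x := laplace_one_pos hC hne x
  have hf : fderiv ℝ (cumulant C) = fun x => (L x)⁻¹ • L₁ x :=
    funext fun x => (hasFDerivAt_cumulant hC hne x).fderiv
  have hinv : HasFDerivAt (fun x => (L x)⁻¹) (-(L x ^ 2)⁻¹ • L₁ x) x :=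
    (hasDerivAt_inv hLpos.ne').comp_hasFDerivAt x (hasFDerivAt_laplace h0 x)
  have hd : fderiv ℝ (fun x => (L x)⁻¹ • L₁ x) x =
      (L x)⁻¹ • L₂ x + (-(L x ^ 2)⁻¹ • L₁ x).smulRight (L₁ x) :=
    (hinv.smul (hasFDerivAt_laplace h0.innerMul x)).fderiv
  have hv₁ : L₁ x v = ∫ y, Real.exp ⟪x, y⟫ * ⟪v, y⟫ ∂gaussianOn C := by
    rw [hL₁, laplace_innerMul_apply h0]; simp [laplace]
  have hv₂ : L₂ x v v = ∫ y, Real.exp ⟪x, y⟫ * ⟪v, y⟫ ^ 2 ∂gaussianOn C := by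
    have e : L₂ x v = laplace (gaussianOn C)
        (innerMul (fun y => ⟪v, y⟫ • (1 : ℝ))) x := by
      rw [hL₂, laplace_innerMul_apply h0.innerMul]
      congr 1
      ext y w
      simp [innerMul]
      ring
    rw [e, laplace_innerMul_apply (h0.inner_smul v)]
    simp [laplace, pow_two]
  have hv₀ : L x = ∫ y, Real.exp ⟪x, y⟫ ∂gaussianOn C := by simp [hL, laplace]
  have i₀ : Integrable (fun y => Real.exp ⟪x, y⟫) (gaussianOn C) := by
    simpa using h0.integrable x
  have i₁ : Integrable (fun y => Real.exp ⟪x, y⟫ * ⟪v, y⟫) (gaussianOn C) := by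
    simpa using (h0.inner_smul v).integrable x
  have i₂ : Integrable (fun y => Real.exp ⟪x, y⟫ * ⟪v, y⟫ ^ 2) (gaussianOn C) := by
    simpa [pow_two] using ((h0.inner_smul v).inner_smul v).integrable x
  set a := L₁ x v / L x with ha
  have hexp : ∀ y, Real.exp ⟪x, y⟫ * (⟪v, y⟫ - a) ^ 2 = Real.exp ⟪x, y⟫ * ⟪v, y⟫ ^ 2
      - 2 * a * (Real.exp ⟪x, y⟫ * ⟪v, y⟫) + a ^ 2 * Real.exp ⟪x, y⟫ := fun y => by ring
  have i₃ : Integrable (fun y => Real.exp ⟪x, y⟫ * (⟪v, y⟫ - a) ^ 2) (gaussianOn C) := by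
    simp only [hexp]
    exact (i₂.sub (i₁.const_mul _)).add (i₀.const_mul _)
  have hpos : 0 < ∫ y, Real.exp ⟪x, y⟫ * (⟪v, y⟫ - a) ^ 2 ∂gaussianOn C := by
    refine integral_gaussianOn_pos hC (by fun_prop) i₃ (fun y _ => by positivity) ?_
    obtain ⟨y, hy, hya⟩ := exists_inner_ne hC hne hv a
    have := sub_ne_zero.2 hya
    exact ⟨y, hy, by positivity⟩
  simp only [hexp] at hpos
  rw [integral_add (by exact i₂.sub (i₁.const_mul _)) (i₀.const_mul _),
    integral_sub i₂ (i₁.const_mul _), integral_const_mul, integral_const_mul,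
    ← hv₀, ← hv₁, ← hv₂] at hpos
  have hval : iteratedFDeriv ℝ 2 (cumulant C) x ![v, v] =
      (L x)⁻¹ * (L₂ x v v - 2 * a * L₁ x v + a ^ 2 * L x) := by
    rw [iteratedFDeriv_two_apply, hf, hd]
    simp [ha]
    field_simp
    ring
  rw [hval]
  positivity

theorem inner_gradient_cumulant (hC : IsOpen C) (hne : C.Nonempty) (x v : E) :
    ⟪gradient (cumulant C) x, v⟫ * laplace (gaussianOn C) (fun _ => (1 : ℝ)) x =
      ∫ y, Real.exp ⟪x, y⟫ * ⟪v, y⟫ ∂gaussianOn C := by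
  have h := laplace_one_pos hC hne x
  rw [gradient, InnerProductSpace.toDual_symm_apply, (hasFDerivAt_cumulant hC hne x).fderiv,
    smul_apply, laplace_innerMul_apply (expIntegrable_one C), smul_eq_mul,
    inv_mul_eq_div, div_mul_cancel₀ _ h.ne']
  simp [laplace]

theorem gradient_cumulant_mem (hC : IsOpen C) (hconv : Convex ℝ C) (hne : C.Nonempty) (x : E) :
    gradient (cumulant C) x ∈ C := by
  by_contra hm
  set m := gradient (cumulant C) x
  obtain ⟨g, hg⟩ := geometric_hahn_banach_open_point hconv hC hm
  obtain ⟨w, rfl⟩ := (InnerProductSpace.toDual ℝ E).surjective g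
  simp only [InnerProductSpace.toDual_apply_apply] at hg
  have h0 := expIntegrable_one C
  have i₀ : Integrable (fun y => Real.exp ⟪x, y⟫) (gaussianOn C) := by
    simpa using h0.integrable x
  have i₁ : Integrable (fun y => Real.exp ⟪x, y⟫ * ⟪w, y⟫) (gaussianOn C) := by
    simpa using (h0.inner_smul w).integrable x
  have hpos : 0 < ∫ y, (⟪w, m⟫ * Real.exp ⟪x, y⟫ - Real.exp ⟪x, y⟫ * ⟪w, y⟫) ∂gaussianOn C := by
    have hlt : ∀ y ∈ C, 0 < ⟪w, m⟫ * Real.exp ⟪x, y⟫ - Real.exp ⟪x, y⟫ * ⟪w, y⟫ := fun y hy => by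
      have := mul_pos (Real.exp_pos ⟪x, y⟫) (sub_pos.2 (hg y hy))
      linarith
    exact integral_gaussianOn_pos hC (by fun_prop) ((i₀.const_mul _).sub i₁)
      (fun y hy => (hlt y hy).le) (hne.imp fun y hy => ⟨hy, hlt y hy⟩)
  have hm' := inner_gradient_cumulant hC hne x w
  rw [integral_sub (i₀.const_mul _) i₁, integral_const_mul, ← hm', real_inner_comm] at hpos
  simp [laplace, m] at hpos

theorem exists_le_cumulant_sub_inner (hC : IsOpen C) {y₀ : E} (hy₀ : y₀ ∈ C) :
    ∃ s > 0, ∃ b : ℝ, ∀ x, s * ‖x‖ + b ≤ cumulant C x - ⟪x, y₀⟫ := by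
  obtain ⟨r, hr, hrC⟩ := Metric.isOpen_iff.1 hC y₀ hy₀
  obtain ⟨c, hc, hball⟩ := exists_le_gaussianOn_ball (s := r / 4) (by positivity) hrC
  refine ⟨r / 4, by positivity, Real.log c, fun x => ?_⟩
  set z := y₀ + (r / 2) • (‖x‖⁻¹ • x) with hz
  have hzy : ‖z - y₀‖ ≤ r / 2 := by
    rw [hz, add_sub_cancel_left, norm_smul, Real.norm_of_nonneg (by positivity), norm_smul,
      norm_inv, norm_norm]
    exact mul_le_of_le_one_right (by positivity) (inv_mul_le_one (a := ‖x‖))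
  have hxz : ⟪x, z⟫ = ⟪x, y₀⟫ + r / 2 * ‖x‖ := by
    rw [hz, inner_add_right, inner_smul_right, inner_smul_right, real_inner_self_eq_norm_sq]
    rcases eq_or_ne ‖x‖ 0 with h | h
    · simp [h]
    · field_simp
  have hsub : Metric.ball z (r / 4) ⊆ Metric.ball y₀ r :=
    Metric.ball_subset_ball' (by rw [dist_eq_norm]; linarith)
  have i₀ : Integrable (fun y => Real.exp ⟪x, y⟫) (gaussianOn C) := by
    simpa using (expIntegrable_one C).integrable x
  have h1 : Real.exp (⟪x, y₀⟫ + r / 4 * ‖x‖) * c ≤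
      laplace (gaussianOn C) (fun _ => (1 : ℝ)) x := by
    calc _ ≤ Real.exp (⟪x, y₀⟫ + r / 4 * ‖x‖) * (gaussianOn C).real (Metric.ball z (r / 4)) := by
          gcongr; exact hball z hsub
      _ ≤ ∫ y in Metric.ball z (r / 4), Real.exp ⟪x, y⟫ ∂gaussianOn C := by
          refine setIntegral_ge_of_const_le_real measurableSet_ball (measure_ne_top _ _)
            (fun y hy => ?_) i₀.integrableOn
          rw [Metric.mem_ball, dist_comm, dist_eq_norm] at hy
          have h2 := (real_inner_le_norm x (z - y)).trans
            (mul_le_mul_of_nonneg_left hy.le (norm_nonneg x))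
          rw [inner_sub_right] at h2
          gcongr
          linarith
      _ ≤ ∫ y, Real.exp ⟪x, y⟫ ∂gaussianOn C :=
          setIntegral_le_integral i₀ (ae_of_all _ fun y => (Real.exp_pos _).le)
      _ = _ := by simp [laplace]
  have h2 := Real.log_le_log (by positivity) h1
  rw [Real.log_mul (Real.exp_pos _).ne' hc.ne', Real.log_exp] at h2
  rw [cumulant]
  linarith

theorem mem_range_gradient_cumulant (hC : IsOpen C) {y₀ : E} (hy₀ : y₀ ∈ C) :
    y₀ ∈ range (gradient (cumulant C)) := by
  have hne : C.Nonempty := ⟨y₀, hy₀⟩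
  obtain ⟨s, hs, b, hb⟩ := exists_le_cumulant_sub_inner hC hy₀
  have hlim : Tendsto (fun x => cumulant C x - ⟪x, y₀⟫) (cocompact E) atTop :=
    tendsto_atTop_mono hb (tendsto_atTop_add_const_right _ _
      ((tendsto_norm_cocompact_atTop (E := E)).const_mul_atTop hs))
  have hcont : Continuous fun x => cumulant C x - ⟪x, y₀⟫ :=
    (contDiff_cumulant hC hne).continuous.sub (by fun_prop)
  obtain ⟨x, hx⟩ := hcont.exists_forall_le hlim
  have hinner : HasFDerivAt (fun z : E => ⟪z, y₀⟫) (innerSL ℝ y₀) x := by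
    simpa [real_inner_comm] using (innerSL ℝ y₀).hasFDerivAt (x := x)
  have hcrit := IsLocalMin.hasFDerivAt_eq_zero (Eventually.of_forall hx)
    ((hasFDerivAt_cumulant hC hne x).differentiableAt.hasFDerivAt.sub hinner)
  refine ⟨x, ?_⟩
  rw [gradient, sub_eq_zero.1 hcrit, LinearIsometryEquiv.symm_apply_eq]
  ext v
  simp

end Gaussian

end LegendreGradientRange

/-- For every nonempty open convex subset `C ⊆ ℝⁿ` there exists a `C²`
function `f : ℝⁿ → ℝ` with `d²f(x)` positive definite for every `x` (hence a `C²`-Legendre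
function on `ℝⁿ`) such that `∇f(ℝⁿ) = C`. -/
theorem exists_legendre_gradient_range_eq
    {n : ℕ} (C : Set (EuclideanSpace ℝ (Fin n)))
    (hCopen : IsOpen C) (hCconv : Convex ℝ C) (hCne : C.Nonempty) :
    ∃ f : EuclideanSpace ℝ (Fin n) → ℝ,
      ContDiff ℝ 2 f ∧
      (∀ x : EuclideanSpace ℝ (Fin n), ∀ v : EuclideanSpace ℝ (Fin n), v ≠ 0 →
        0 < iteratedFDeriv ℝ 2 f x ![v, v]) ∧
      Set.range (gradient f) = C := by
  exact ⟨LegendreGradientRange.cumulant C,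
    LegendreGradientRange.contDiff_cumulant hCopen hCne,
    fun x _ hv => LegendreGradientRange.iteratedFDeriv_two_cumulant_pos hCopen hCne x hv,
    Subset.antisymm
      (range_subset_iff.2 (LegendreGradientRange.gradient_cumulant_mem hCopen hCconv hCne))
      fun _ hy => LegendreGradientRange.mem_range_gradient_cumulant hCopen hy⟩
end

section
/- Let f₁, f₂ : ℝⁿ → ℝ be C² functions whose second differentials d²f₁(x) and d²f₂(x) are positive definite for every x ∈ ℝⁿ (i.e. f₁ and f₂ are C²-Legendre functions on ℝⁿ). Then the image of the gradient of the sum is the Minkowski sum of the images of the gradients: ∇(f₁ + f₂)(ℝⁿ) = ∇f₁(ℝⁿ) + ∇f₂(ℝⁿ), where A + B = {a + b : a ∈ A, b ∈ B}. -/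
open Pointwise Filter

/-- A `C²` function whose second differential is everywhere positive definite is strictly
convex. -/
theorem strictConvexOn_univ_of_iteratedFDeriv_two_pos {E : Type*} [NormedAddCommGroup E]
    [NormedSpace ℝ E] {f : E → ℝ} (hf : ContDiff ℝ 2 f)
    (hpos : ∀ x v : E, v ≠ 0 → 0 < iteratedFDeriv ℝ 2 f x ![v, v]) :
    StrictConvexOn ℝ Set.univ f := by
  refine ⟨convex_univ, fun x _ y _ hxy a b ha hb hab => ?_⟩
  have hv : y - x ≠ 0 := sub_ne_zero.2 hxy.symm
  have hline : ∀ t : ℝ, HasDerivAt (fun t : ℝ => x + t • (y - x)) (y - x) t := fun t => by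
    simpa using ((hasDerivAt_id t).smul_const (y - x)).const_add x
  have hd1 : ∀ t : ℝ, HasDerivAt (fun t : ℝ => f (x + t • (y - x)))
      (fderiv ℝ f (x + t • (y - x)) (y - x)) t := fun t =>
    ((hf.differentiable (by norm_num)) _).hasFDerivAt.comp_hasDerivAt t (hline t)
  have hf' : Differentiable ℝ (fderiv ℝ f) :=
    (hf.fderiv_right (m := 1) (by norm_num)).differentiable (by norm_num)
  have hd2 : ∀ t : ℝ, HasDerivAt (fun t : ℝ => fderiv ℝ f (x + t • (y - x)) (y - x))
      (fderiv ℝ (fderiv ℝ f) (x + t • (y - x)) (y - x) (y - x)) t := fun t => by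
    have h := (hf' (x + t • (y - x))).hasFDerivAt.comp_hasDerivAt t (hline t)
    simpa using h.clm_apply (hasDerivAt_const t (y - x))
  have hconv : StrictConvexOn ℝ Set.univ (fun t : ℝ => f (x + t • (y - x))) := by
    refine strictConvexOn_univ_of_deriv2_pos
      (continuous_iff_continuousAt.2 fun t => (hd1 t).continuousAt) fun t => ?_
    have h1 : deriv (fun t : ℝ => f (x + t • (y - x))) =
        fun t => fderiv ℝ f (x + t • (y - x)) (y - x) := funext fun t => (hd1 t).deriv
    rw [Function.iterate_succ, Function.comp_apply, Function.iterate_one, h1, (hd2 t).deriv]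
    simpa [iteratedFDeriv_two_apply] using hpos (x + t • (y - x)) (y - x) hv
  have h := hconv.2 (Set.mem_univ 0) (Set.mem_univ 1) zero_ne_one ha hb hab
  have hpt : x + b • (y - x) = a • x + b • y := by
    rw [← eq_sub_iff_add_eq] at hab
    rw [hab]
    module
  simpa [hpt] using h

/-- A convex function lies above its tangent hyperplanes. -/
theorem ConvexOn.add_hasFDerivAt_apply_le {E : Type*} [NormedAddCommGroup E] [NormedSpace ℝ E]
    {f : E → ℝ} (hf : ConvexOn ℝ Set.univ f) {x : E} {f' : E →L[ℝ] ℝ}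
    (hx : HasFDerivAt f f' x) (y : E) : f x + f' (y - x) ≤ f y := by
  have hconv : ConvexOn ℝ Set.univ (f ∘ AffineMap.lineMap (k := ℝ) x y) := by
    simpa using hf.comp_affineMap (AffineMap.lineMap (k := ℝ) x y)
  have hd : HasDerivAt (f ∘ AffineMap.lineMap (k := ℝ) x y) (f' (y - x)) 0 := by
    have hx' : HasFDerivAt f f' (AffineMap.lineMap (k := ℝ) x y (0 : ℝ)) := by simpa using hx
    exact hx'.comp_hasDerivAt 0 AffineMap.hasDerivAt_lineMap
  have h := hconv.le_slope_of_hasDerivAt (Set.mem_univ 0) (Set.mem_univ 1) zero_lt_one hd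
  simp only [slope_def_field, Function.comp_apply, AffineMap.lineMap_apply_zero,
    AffineMap.lineMap_apply_one, sub_zero, div_one] at h
  linarith

/-- In finite dimension, a continuous strictly convex function that attains its minimum is
coercive. -/
theorem StrictConvexOn.tendsto_cocompact_atTop {E : Type*} [NormedAddCommGroup E]
    [NormedSpace ℝ E] [FiniteDimensional ℝ E] {f : E → ℝ} (hf : StrictConvexOn ℝ Set.univ f)
    (hcont : Continuous f) {x : E} (hx : ∀ y, f x ≤ f y) :
    Tendsto f (cocompact E) atTop := by
  have : ProperSpace E := FiniteDimensional.proper_real E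
  obtain ⟨δ, hδ, hsphere⟩ : ∃ δ > 0, ∀ z ∈ Metric.sphere x 1, f x + δ ≤ f z := by
    rcases (Metric.sphere x 1).eq_empty_or_nonempty with h | h
    · exact ⟨1, one_pos, by simp [h]⟩
    · obtain ⟨w, hw, hmin⟩ := (isCompact_sphere x 1).exists_isMinOn h hcont.continuousOn
      refine ⟨f w - f x, sub_pos.2 <| (hx w).lt_of_ne fun heq => ?_, fun z hz => ?_⟩
      · have hwx : w = x := hf.eq_of_isMinOn (fun y _ => heq ▸ hx y) (fun y _ => hx y)
          (Set.mem_univ _) (Set.mem_univ _)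
        simp [hwx] at hw
      · have : f w ≤ f z := hmin hz
        linarith
  have hgrowth : ∀ y, 1 ≤ dist y x → f x + δ * dist y x ≤ f y := fun y hy => by
    have hr : 0 < dist y x := one_pos.trans_le hy
    have hz : (1 - (dist y x)⁻¹) • x + (dist y x)⁻¹ • y ∈ Metric.sphere x 1 := by
      have : (1 - (dist y x)⁻¹) • x + (dist y x)⁻¹ • y - x = (dist y x)⁻¹ • (y - x) := by module
      rw [mem_sphere_iff_norm, this, norm_smul, ← dist_eq_norm, norm_inv, Real.norm_eq_abs,
        abs_of_pos hr, inv_mul_cancel₀ hr.ne']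
    have h1 := hsphere _ hz
    have h2 := hf.convexOn.2 (Set.mem_univ x) (Set.mem_univ y)
      (sub_nonneg.2 (inv_le_one_of_one_le₀ hy)) (inv_nonneg.2 hr.le) (sub_add_cancel _ _)
    simp only [smul_eq_mul] at h2
    have h3 : δ ≤ (dist y x)⁻¹ * (f y - f x) := by linarith
    rw [inv_mul_eq_div, le_div_iff₀ hr] at h3
    linarith
  have hlim : Tendsto (fun y => f x + δ * dist y x) (cocompact E) atTop :=
    tendsto_atTop_add_const_left _ _ ((tendsto_dist_right_cocompact_atTop x).const_mul_atTop hδ)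
  refine tendsto_atTop_mono' _ ?_ hlim
  filter_upwards [(tendsto_dist_right_cocompact_atTop x).eventually_ge_atTop 1] with y hy
  exact hgrowth y hy

/-- For differentiable strictly convex functions on a finite-dimensional space, the sum of a
derivative of one and a derivative of the other is a derivative of the sum. -/
theorem StrictConvexOn.exists_fderiv_add_eq {E : Type*} [NormedAddCommGroup E]
    [NormedSpace ℝ E] [FiniteDimensional ℝ E] {f g : E → ℝ} (hf : StrictConvexOn ℝ Set.univ f)
    (hg : ConvexOn ℝ Set.univ g) (hdf : Differentiable ℝ f) (hdg : Differentiable ℝ g)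
    (x y : E) : ∃ z, fderiv ℝ f z + fderiv ℝ g z = fderiv ℝ f x + fderiv ℝ g y := by
  set L := fderiv ℝ f x
  set M := fderiv ℝ g y
  have hf_min : ∀ z, f x - L x ≤ f z - L z := fun z => by
    have := hf.convexOn.add_hasFDerivAt_apply_le (hdf x).hasFDerivAt z
    rw [map_sub] at this
    linarith
  have hg_min : ∀ z, g y - M y ≤ g z - M z := fun z => by
    have := hg.add_hasFDerivAt_apply_le (hdg y).hasFDerivAt z
    rw [map_sub] at this
    linarith
  have hfL : StrictConvexOn ℝ Set.univ (fun z => f z - L z) :=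
    hf.sub_concaveOn (L.toLinearMap.concaveOn convex_univ)
  have hcoer : Tendsto (fun z => (f z - L z) + (g z - M z)) (cocompact E) atTop :=
    tendsto_atTop_add_right_of_le _ _
      (hfL.tendsto_cocompact_atTop (hdf.continuous.sub L.continuous) hf_min) hg_min
  obtain ⟨z, hz⟩ := ((hdf.continuous.sub L.continuous).add
    (hdg.continuous.sub M.continuous)).exists_forall_le hcoer
  refine ⟨z, ?_⟩
  have hd : HasFDerivAt (fun z => (f z - L z) + (g z - M z))
      ((fderiv ℝ f z - L) + (fderiv ℝ g z - M)) z :=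
    ((hdf z).hasFDerivAt.sub L.hasFDerivAt).add ((hdg z).hasFDerivAt.sub M.hasFDerivAt)
  have h0 := IsLocalMin.hasFDerivAt_eq_zero (Eventually.of_forall hz) hd
  rw [← sub_eq_zero, ← h0]
  abel

/-- If `f₁, f₂ : ℝⁿ → ℝ` are `C²` functions with everywhere positive
definite second differentials (`C²`-Legendre functions on `ℝⁿ`), then
`∇(f₁ + f₂)(ℝⁿ) = ∇f₁(ℝⁿ) + ∇f₂(ℝⁿ)` (Minkowski sum). -/
theorem gradient_range_add
    {n : ℕ} (f₁ f₂ : EuclideanSpace ℝ (Fin n) → ℝ)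
    (hC1 : ContDiff ℝ 2 f₁) (hC2 : ContDiff ℝ 2 f₂)
    (hpos1 : ∀ x : EuclideanSpace ℝ (Fin n), ∀ v : EuclideanSpace ℝ (Fin n), v ≠ 0 →
      0 < iteratedFDeriv ℝ 2 f₁ x ![v, v])
    (hpos2 : ∀ x : EuclideanSpace ℝ (Fin n), ∀ v : EuclideanSpace ℝ (Fin n), v ≠ 0 →
      0 < iteratedFDeriv ℝ 2 f₂ x ![v, v]) :
    Set.range (gradient (fun x => f₁ x + f₂ x)) =
      Set.range (gradient f₁) + Set.range (gradient f₂) := by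
  have hd1 : Differentiable ℝ f₁ := hC1.differentiable (by norm_num)
  have hd2 : Differentiable ℝ f₂ := hC2.differentiable (by norm_num)
  have hadd : ∀ z, gradient (fun x => f₁ x + f₂ x) z = gradient f₁ z + gradient f₂ z := fun z => by
    simp only [gradient, fderiv_fun_add (hd1 z) (hd2 z), map_add]
  ext p
  rw [Set.mem_add]
  constructor
  · rintro ⟨z, rfl⟩
    exact ⟨_, ⟨z, rfl⟩, _, ⟨z, rfl⟩, (hadd z).symm⟩
  · rintro ⟨_, ⟨x, rfl⟩, _, ⟨y, rfl⟩, rfl⟩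
    obtain ⟨z, hz⟩ := StrictConvexOn.exists_fderiv_add_eq
      (strictConvexOn_univ_of_iteratedFDeriv_two_pos hC1 hpos1)
      (strictConvexOn_univ_of_iteratedFDeriv_two_pos hC2 hpos2).convexOn hd1 hd2 x y
    refine ⟨z, (hadd z).trans ?_⟩
    simp only [gradient, ← map_add, hz]
end

section
/- Let K be a field of characteristic 0, let n, k ≥ 1, and for a multiindex I = (i₁,…,i_k) ∈ ℕ₀^k let Iy denote the linear form Iy = Σ_{j=1}^k i_j y_j in the polynomial ring K[y₁,…,y_k]. Then the family of polynomials ((Iy)^n)_{I ∈ Δ_k^n}, indexed by the multiindices I of degree |I| = n, is a basis of the K-vector space of homogeneous polynomials of degree n in y₁,…,y_k. -/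
open MvPolynomial

/-- If `∑ I, c I • (∑ j, a I j X j) ^ n = 0`, then pairing with a homogeneous polynomial `f` of
degree `n` gives `∑ I, c I * f (a I) = 0`. -/
theorem sum_mul_eval_eq_zero_of_sum_smul_pow_eq_zero {K σ ι : Type*} [Field K] [CharZero K]
    [Fintype σ] {n : ℕ} (s : Finset ι) (a : ι → σ → K) (c : ι → K)
    (h : ∑ i ∈ s, c i • (∑ j, C (a i j) * X j : MvPolynomial σ K) ^ n = 0)
    {f : MvPolynomial σ K} (hf : f.IsHomogeneous n) :
    ∑ i ∈ s, c i * eval (a i) f = 0 := by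
  simp_rw [eval_eq', Finset.mul_sum]
  rw [Finset.sum_comm]
  refine Finset.sum_eq_zero fun d hd => ?_
  have hdeg : d.sum (fun _ m => m) = n := by
    have := hf.degree_eq_sum_deg_support hd
    rw [this]; rfl
  have hcoeff := congrArg (coeff d) h
  simp only [coeff_sum, coeff_smul, coeff_zero, ← smul_eq_C_mul,
    coeff_linearCombination_X_pow_of_fintype, if_pos hdeg, smul_eq_mul] at hcoeff
  have hm : (d.multinomial : K) ≠ 0 := by
    rw [Finsupp.multinomial_eq]
    exact_mod_cast (Nat.multinomial_pos _ _).ne'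
  have hsum : ∑ i ∈ s, c i * ∏ j, a i j ^ d j = 0 := by
    refine (mul_eq_zero.mp ?_).resolve_left hm
    rw [← hcoeff, Finset.mul_sum]
    refine Finset.sum_congr rfl fun i _ => ?_
    rw [Finsupp.prod_fintype _ _ fun _ => pow_zero _]
    ring
  rw [← mul_zero (coeff d f), ← hsum, Finset.mul_sum]
  exact Finset.sum_congr rfl fun i _ => by ring

/-- The homogenization of `∏ j, X j (X j - 1) ⋯ (X j - I j + 1)` with respect to the linear form
`(∑ j, X j) / n`. -/
noncomputable def homogeneousFallingFactorial (K : Type*) {σ : Type*} [Field K] [Fintype σ]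
    (n : ℕ) (I : σ → ℕ) : MvPolynomial σ K :=
  ∏ j, ∏ m ∈ Finset.range (I j), (X j - C ((m : K) / n) * ∑ l, X l)

theorem isHomogeneous_homogeneousFallingFactorial (K : Type*) {σ : Type*} [Field K] [Fintype σ]
    (n : ℕ) (I : σ → ℕ) : (homogeneousFallingFactorial K n I).IsHomogeneous (∑ j, I j) := by
  refine IsHomogeneous.prod _ _ _ fun j _ => ?_
  have h : (∏ m ∈ Finset.range (I j),
      (X j - C ((m : K) / n) * ∑ l, X l : MvPolynomial σ K)).IsHomogeneous
        (∑ _m ∈ Finset.range (I j), 1) :=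
    IsHomogeneous.prod _ _ _ fun m _ => (isHomogeneous_X K j).sub <| by
      simpa using (isHomogeneous_C σ ((m : K) / n)).mul
        (IsHomogeneous.sum Finset.univ (fun l => (X l : MvPolynomial σ K)) 1
          fun l _ => isHomogeneous_X K l)
  simpa using h

theorem eval_homogeneousFallingFactorial {K σ : Type*} [Field K] [CharZero K] [Fintype σ]
    {n : ℕ} (hn : n ≠ 0) (I : σ → ℕ) {J : σ → ℕ} (hJ : ∑ j, J j = n) :
    eval (fun j => (J j : K)) (homogeneousFallingFactorial K n I) =
      ((∏ j, (J j).descFactorial (I j) : ℕ) : K) := by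
  have hn' : (n : K) ≠ 0 := Nat.cast_ne_zero.mpr hn
  have hJ' : ∑ j, (J j : K) = n := by exact_mod_cast hJ
  simp only [homogeneousFallingFactorial, map_prod, map_sub, map_mul, map_sum, eval_X, eval_C,
    hJ', div_mul_cancel₀ _ hn', Nat.cast_prod]
  refine Finset.prod_congr rfl fun j _ => ?_
  rw [← descPochhammer_eval_eq_descFactorial, descPochhammer_eval_eq_prod_range]

theorem prod_descFactorial_eq_zero_of_ne {σ : Type*} [Fintype σ] {I J : σ → ℕ}
    (h : ∑ j, I j = ∑ j, J j) (hne : J ≠ I) : ∏ j, (J j).descFactorial (I j) = 0 := by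
  by_contra hprod
  refine hne (funext fun j => ?_)
  have hle : ∀ j ∈ Finset.univ, I j ≤ J j := fun j hj => by
    have := Finset.prod_ne_zero_iff.mp hprod j hj
    rwa [Ne, Nat.descFactorial_eq_zero_iff_lt, not_lt] at this
  exact ((Finset.sum_eq_sum_iff_of_le hle).mp h j (Finset.mem_univ j)).symm

theorem linearIndependent_linear_form_pow (K : Type*) {σ : Type*} [Field K] [CharZero K]
    [Fintype σ] {n : ℕ} (hn : n ≠ 0) :
    LinearIndependent K (fun I : {I : σ → ℕ // ∑ j, I j = n} =>
      (∑ j, C ((I.1 j : K)) * X j : MvPolynomial σ K) ^ n) := by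
  rw [linearIndependent_iff']
  intro s c h I hI
  have hzero := sum_mul_eval_eq_zero_of_sum_smul_pow_eq_zero s (fun J j => (J.1 j : K)) c h
    (I.2 ▸ isHomogeneous_homogeneousFallingFactorial K n I.1)
  have heval (J : {J : σ → ℕ // ∑ j, J j = n}) :=
    eval_homogeneousFallingFactorial (K := K) hn I.1 J.2
  simp only [heval] at hzero
  rw [Finset.sum_eq_single_of_mem I hI fun J _ hJ => by
    rw [prod_descFactorial_eq_zero_of_ne (I.2.trans J.2.symm) (Subtype.coe_injective.ne hJ),
      Nat.cast_zero, mul_zero]] at hzero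
  refine (mul_eq_zero.mp hzero).resolve_right ?_
  simp [Finset.prod_ne_zero_iff, Nat.descFactorial_self, Nat.factorial_ne_zero]

theorem finrank_homogeneousSubmodule (K : Type*) {σ : Type*} [Field K] [Fintype σ] (n : ℕ) :
    Module.finrank K (homogeneousSubmodule σ K n) =
      Nat.card {I : σ → ℕ // ∑ j, I j = n} := by
  rw [homogeneousSubmodule_eq_finsupp_supported,
    Module.finrank_eq_nat_card_basis
      (Module.Basis.ofRepr (AddMonoidAlgebra.supportedEquivFinsupp (R := K) (S := K)
        {d : σ →₀ ℕ | d.degree = n}))]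
  exact Nat.card_congr <| Finsupp.equivFunOnFinite.subtypeEquiv fun d => by
    simp [Finsupp.degree_eq_sum]

/-- Let `K` be a field of characteristic `0` and `n, k ≥ 1`.  For a
multiindex `I = (i₁,…,i_k)` let `Iy = Σⱼ iⱼ yⱼ` be the corresponding linear form in
`K[y₁,…,y_k]`.  Then the family `((Iy)^n)` indexed by the multiindices of degree `n` is a
basis of the `K`-vector space of homogeneous polynomials of degree `n`: it is linearly
independent and spans the homogeneous submodule of degree `n`. -/
theorem linear_form_powers_basis
    (K : Type*) [Field K] [CharZero K] (n k : ℕ) (hn : 1 ≤ n) (hk : 1 ≤ k) :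
    LinearIndependent K
      (fun I : {I : Fin k → ℕ // ∑ j, I j = n} =>
        (∑ j, MvPolynomial.C ((I.1 j : K)) * MvPolynomial.X j) ^ n) ∧
    Submodule.span K
      (Set.range (fun I : {I : Fin k → ℕ // ∑ j, I j = n} =>
        (∑ j, MvPolynomial.C ((I.1 j : K)) * MvPolynomial.X j) ^ n)) =
      MvPolynomial.homogeneousSubmodule (Fin k) K n := by
  have hli := linearIndependent_linear_form_pow K (σ := Fin k) (n := n) (by omega)
  have : Module.Finite K (homogeneousSubmodule (Fin k) K n) :=
    Module.Finite.iff_fg.mpr (homogeneousSubmodule_fg (Fin k) K n)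
  have : Finite {I : Fin k → ℕ // ∑ j, I j = n} :=
    ((Finset.univ.piAntidiag n).finite_toSet.subset fun I (hI : ∑ j, I j = n) => by
      simpa using hI).to_subtype
  have := Fintype.ofFinite {I : Fin k → ℕ // ∑ j, I j = n}
  refine ⟨hli, Submodule.eq_of_le_of_finrank_eq ?_ ?_⟩
  · rw [Submodule.span_le]
    rintro _ ⟨I, rfl⟩
    have hlin : (∑ j, C (I.1 j : K) * X j : MvPolynomial (Fin k) K).IsHomogeneous 1 :=
      IsHomogeneous.sum _ _ _ fun j _ => isHomogeneous_C_mul_X _ j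
    simpa using hlin.pow n
  · rw [finrank_span_eq_card hli, finrank_homogeneousSubmodule, Nat.card_eq_fintype_card]
end

section
/- Let n, k ≥ 1 and let f : Δ_k^n → ℝ be a 1-concave function, i.e. for every I ∈ Δ_k^n and all distinct indices p, q ∈ {1,…,k} such that both I + e_p − e_q and I − e_p + e_q lie in Δ_k^n (componentwise nonnegative), one has 2·f(I) ≥ f(I + e_p − e_q) + f(I − e_p + e_q). Then for every I = (i₁,…,i_k) ∈ Δ_k^n one has f(i₁,…,i_k) ≥ Σ_{j=1}^k (i_j/n)·f(n·e_j), and consequently e^{f(I)} ≥ Π_{j=1}^k (e^{f(n·e_j)})^{i_j/n}, where e₁,…,e_k are the standard basis multiindices. -/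
/-- The multiindex `I + e_p - e_q`. -/
def shiftIndex {ι : Type*} [DecidableEq ι] (I : ι → ℕ) (p q : ι) : ι → ℕ :=
  fun j => I j + (if j = p then 1 else 0) - (if j = q then 1 else 0)

/-- The multiindex `n · e_j`. -/
def vertexIndex {ι : Type*} [DecidableEq ι] (n : ℕ) (j : ι) : ι → ℕ :=
  fun i => if i = j then n else 0

section

variable {ι : Type*} [DecidableEq ι]

lemma cast_shiftIndex (I : ι → ℕ) (p q j : ι) (hq : 1 ≤ I q) :
    (shiftIndex I p q j : ℝ) =
      I j + (if j = p then 1 else 0) - (if j = q then 1 else 0) := by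
  unfold shiftIndex
  rw [Nat.cast_sub]
  · push_cast
    rfl
  · split_ifs <;> subst_vars <;> omega

variable [Fintype ι]

lemma sum_shiftIndex_mul (I : ι → ℕ) (p q : ι) (hq : 1 ≤ I q) (c : ι → ℝ) :
    ∑ j, (shiftIndex I p q j : ℝ) * c j = ∑ j, (I j : ℝ) * c j + c p - c q := by
  simp [cast_shiftIndex I p q _ hq, add_mul, sub_mul, Finset.sum_add_distrib]

lemma sum_shiftIndex (I : ι → ℕ) (p q : ι) (hq : 1 ≤ I q) :
    ∑ j, shiftIndex I p q j = ∑ j, I j := by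
  have h := sum_shiftIndex_mul I p q hq (fun _ => 1)
  simp only [mul_one, add_sub_cancel_right] at h
  exact_mod_cast h

lemma sum_sq_shiftIndex (I : ι → ℕ) {p q : ι} (hpq : p ≠ q) (hq : 1 ≤ I q) :
    ∑ j, (shiftIndex I p q j : ℝ) ^ 2 = ∑ j, (I j : ℝ) ^ 2 + 2 * I p - 2 * I q + 2 := by
  have h : ∀ j, (shiftIndex I p q j : ℝ) ^ 2 =
      (I j : ℝ) ^ 2 + (if j = p then 2 * (I p : ℝ) + 1 else 0) +
        (if j = q then 1 - 2 * (I q : ℝ) else 0) := by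
    intro j
    rw [cast_shiftIndex I p q j hq]
    by_cases hp : j = p
    · subst hp
      simp only [if_true, if_neg hpq]
      ring
    · by_cases hj : j = q
      · subst hj
        simp only [if_true, if_neg hp]
        ring
      · simp [hp, hj]
  simp only [h, Finset.sum_add_distrib, Finset.sum_ite_eq', Finset.mem_univ, if_true]
  ring

lemma eq_vertexIndex_of_forall_eq_zero {n : ℕ} {I : ι → ℕ} (hI : ∑ j, I j = n) {p : ι}
    (h : ∀ q, q ≠ p → I q = 0) : I = vertexIndex n p := by
  have hp : I p = n := by
    rw [← hI]
    exact (Finset.sum_eq_single p (fun q _ hq => h q hq) (by simp)).symm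
  ext i
  by_cases hi : i = p
  · simp [vertexIndex, hi, hp]
  · simp [vertexIndex, hi, h i hi]

/-- A `1`-concave function on the discrete simplex attains its minimum at a vertex. -/
lemma exists_vertexIndex_le_of_one_concave {n : ℕ} (hn : 1 ≤ n) (g : (ι → ℕ) → ℝ)
    (hg : ∀ I : ι → ℕ, ∑ j, I j = n → ∀ p q, p ≠ q → 1 ≤ I p → 1 ≤ I q →
      g (shiftIndex I p q) + g (shiftIndex I q p) ≤ 2 * g I)
    {J : ι → ℕ} (hJ : ∑ j, J j = n) :
    ∃ p, g (vertexIndex n p) ≤ g J := by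
  have hmem : ∀ I : ι → ℕ, I ∈ Finset.piAntidiag Finset.univ n ↔ ∑ j, I j = n := by
    simp
  obtain ⟨M, hM, hMmin⟩ := Finset.exists_min_image (Finset.piAntidiag Finset.univ n) g
    ⟨J, (hmem J).2 hJ⟩
  -- Among the minimisers, take one of maximal Euclidean norm.
  obtain ⟨I, hI, hImax⟩ := Finset.exists_max_image
    ((Finset.piAntidiag Finset.univ n).filter fun I => g I = g M)
    (fun I => ∑ j, (I j : ℝ) ^ 2) ⟨M, by simpa using hM⟩
  obtain ⟨hIn, hIM⟩ := Finset.mem_filter.1 hI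
  rw [hmem] at hIn
  have key : ∀ p q, p ≠ q → 1 ≤ I p → 1 ≤ I q → I p < I q := by
    intro p q hpq hp hq
    have h₁ := (sum_shiftIndex I p q hq).trans hIn
    have h₂ := (sum_shiftIndex I q p hp).trans hIn
    have hc := hg I hIn p q hpq hp hq
    have m₁ := hMmin _ ((hmem _).2 h₁)
    have m₂ := hMmin _ ((hmem _).2 h₂)
    have hle := hImax _ (Finset.mem_filter.2 ⟨(hmem _).2 h₁, by linarith⟩)
    simp only [sum_sq_shiftIndex I hpq hq] at hle
    have : (I p : ℝ) < I q := by linarith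
    exact_mod_cast this
  obtain ⟨p, hp⟩ : ∃ p, I p ≠ 0 := by
    by_contra! h
    simp [h] at hIn
    omega
  refine ⟨p, ?_⟩
  rw [← eq_vertexIndex_of_forall_eq_zero hIn (p := p), hIM]
  · exact hMmin J ((hmem J).2 hJ)
  · intro q hq
    by_contra hq0
    have h₁ := key p q hq.symm (by omega) (by omega)
    have h₂ := key q p hq (by omega) (by omega)
    omega

end


/-- Let `n, k ≥ 1` and `f` a `1`-concave function on the discrete simplex
`Δ_k^n = {I ∈ ℕ₀^k : |I| = n}`, i.e. `2·f(I) ≥ f(I + e_p − e_q) + f(I − e_p + e_q)` whenever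
`p ≠ q` and both shifted multiindices lie in `Δ_k^n`.  Then for every `I ∈ Δ_k^n`,
`f(I) ≥ Σⱼ (iⱼ/n)·f(n·eⱼ)`, and consequently
`e^{f(I)} ≥ Πⱼ (e^{f(n·eⱼ)})^{iⱼ/n}`. -/
theorem one_concave_ge_convex_combination_of_vertices
    {k n : ℕ} (hk : 1 ≤ k) (hn : 1 ≤ n)
    (f : (Fin k → ℕ) → ℝ)
    (hconc : ∀ I : Fin k → ℕ, (∑ j, I j = n) → ∀ p q : Fin k, p ≠ q →
      1 ≤ I p → 1 ≤ I q →
      f (fun j => I j + (if j = p then 1 else 0) - (if j = q then 1 else 0)) +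
        f (fun j => I j + (if j = q then 1 else 0) - (if j = p then 1 else 0)) ≤
      2 * f I) :
    ∀ I : Fin k → ℕ, (∑ j, I j = n) →
      (∑ j, ((I j : ℝ) / n) * f (fun i => if i = j then n else 0) ≤ f I) ∧
      (∏ j, Real.exp (f (fun i => if i = j then n else 0)) ^ ((I j : ℝ) / n) ≤
        Real.exp (f I)) := by
  intro I hI
  have hn0 : (n : ℝ) ≠ 0 := by positivity
  have hle : ∑ j, ((I j : ℝ) / n) * f (vertexIndex n j) ≤ f I := by
    have hrw : ∀ J : Fin k → ℕ, ∑ j, ((J j : ℝ) / n) * f (vertexIndex n j) =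
        ∑ j, (J j : ℝ) * (f (vertexIndex n j) / n) := fun J =>
      Finset.sum_congr rfl fun j _ => by ring
    obtain ⟨p, hp⟩ := exists_vertexIndex_le_of_one_concave hn
      (fun J => f J - ∑ j, (J j : ℝ) * (f (vertexIndex n j) / n)) (fun J hJ p q hpq h₁ h₂ => by
        have h := hconc J hJ p q hpq h₁ h₂
        change f (shiftIndex J p q) + f (shiftIndex J q p) ≤ 2 * f J at h
        simp only [sum_shiftIndex_mul J p q h₂, sum_shiftIndex_mul J q p h₁]
        linarith) hI
    have hv : ∑ j, (vertexIndex n p j : ℝ) * (f (vertexIndex n j) / n) =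
        f (vertexIndex n p) := by
      rw [Finset.sum_eq_single p (fun j _ hj => by simp [vertexIndex, hj]) (by simp)]
      simp only [vertexIndex, if_true]
      field_simp
    simp only [hv, sub_self] at hp
    rw [hrw]
    linarith
  refine ⟨hle, ?_⟩
  simp only [← Real.exp_mul, ← Real.exp_sum]
  refine Real.exp_le_exp.2 (le_trans (le_of_eq ?_) hle)
  exact Finset.sum_congr rfl fun j _ => mul_comm _ _
end

section
/- (Brunn–Minkowski inequality) Let Y₁ and Y₂ be nonempty compact convex subsets of ℝⁿ (n ≥ 1) and let Y₁ + Y₂ = {a + b : a ∈ Y₁, b ∈ Y₂} be their Minkowski sum. Then vol(Y₁ + Y₂)^{1/n} ≥ vol(Y₁)^{1/n} + vol(Y₂)^{1/n}, where vol denotes n-dimensional Lebesgue measure. -/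
open MeasureTheory Pointwise

open scoped ENNReal in
/-- Weighted arithmetic-geometric mean inequality in `ℝ≥0∞`. -/
theorem ENNReal.rpow_mul_rpow_le_weighted_add {p q : ℝ} (hp : 0 < p) (hq : 0 < q)
    (hpq : p + q = 1) (x y : ℝ≥0∞) :
    x ^ p * y ^ q ≤ ENNReal.ofReal p * x + ENNReal.ofReal q * y := by
  rcases eq_or_ne x ⊤ with rfl | hx
  · simp [ENNReal.mul_top, hp]
  rcases eq_or_ne y ⊤ with rfl | hy
  · simp [ENNReal.mul_top, hq]
  lift x to NNReal using hx
  lift y to NNReal using hy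
  lift p to NNReal using hp.le
  lift q to NNReal using hq.le
  rw [← ENNReal.coe_rpow_of_nonneg x hp.le, ← ENNReal.coe_rpow_of_nonneg y hq.le,
    ENNReal.ofReal_coe_nnreal, ENNReal.ofReal_coe_nnreal]
  exact_mod_cast NNReal.geom_mean_le_arith_mean2_weighted p q x y (by exact_mod_cast hpq)

/-- One-dimensional Brunn–Minkowski inequality for compact sets. -/
theorem IsCompact.volume_add_volume_le {K L : Set ℝ} (hK : IsCompact K) (hL : IsCompact L)
    (hKne : K.Nonempty) (hLne : L.Nonempty) :
    volume K + volume L ≤ volume (K + L) := by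
  obtain ⟨a, haK, ha⟩ := hK.exists_isGreatest hKne
  obtain ⟨b, hbL, hb⟩ := hL.exists_isLeast hLne
  have hint : AEDisjoint volume (b +ᵥ K) (a +ᵥ L) := by
    refine measure_mono_null (t := {a + b}) ?_ (by simp)
    rintro _ ⟨⟨x, hx, rfl⟩, ⟨y, hy, h⟩⟩
    have h₁ := ha hx
    have h₂ := hb hy
    simp only [vadd_eq_add, Set.mem_singleton_iff] at h ⊢
    linarith
  calc volume K + volume L = volume (b +ᵥ K) + volume (a +ᵥ L) := by simp
    _ = volume ((b +ᵥ K) ∪ (a +ᵥ L)) :=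
      (measure_union₀ (hL.vadd a).measurableSet.nullMeasurableSet hint).symm
    _ ≤ volume (K + L) := by
      refine measure_mono (Set.union_subset ?_ ?_)
      · rintro _ ⟨x, hx, rfl⟩
        exact ⟨x, hx, b, hbL, add_comm _ _⟩
      · rintro _ ⟨y, hy, rfl⟩
        exact ⟨a, haK, y, hy, rfl⟩

/-- One-dimensional Brunn–Minkowski inequality for measurable sets. -/
theorem MeasurableSet.volume_add_volume_le {A B : Set ℝ} (hA : MeasurableSet A)
    (hB : MeasurableSet B) (hAne : A.Nonempty) (hBne : B.Nonempty) :
    volume A + volume B ≤ volume (A + B) := by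
  obtain ⟨a, ha⟩ := hAne
  obtain ⟨b, hb⟩ := hBne
  rcases eq_or_ne (volume A) 0 with hA0 | hA0
  · calc volume A + volume B = volume (a +ᵥ B) := by simp [hA0]
      _ ≤ _ := measure_mono (by rintro _ ⟨y, hy, rfl⟩; exact ⟨a, ha, y, hy, rfl⟩)
  rcases eq_or_ne (volume B) 0 with hB0 | hB0
  · calc volume A + volume B = volume (b +ᵥ A) := by simp [hB0]
      _ ≤ _ := measure_mono (by rintro _ ⟨x, hx, rfl⟩; exact ⟨x, hx, b, hb, add_comm _ _⟩)
  refine le_of_forall_lt fun c hc => ?_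
  obtain ⟨r, hr, s, hs, hc⟩ := ENNReal.exists_lt_add_of_lt_add hc hA0 hB0
  obtain ⟨K, hKA, hK, hr⟩ := hA.exists_lt_isCompact hr
  obtain ⟨L, hLB, hL, hs⟩ := hB.exists_lt_isCompact hs
  refine hc.trans_le ?_
  calc r + s ≤ volume K + volume L := by gcongr
    _ ≤ volume (K + L) := hK.volume_add_volume_le hL
      (nonempty_of_measure_ne_zero hr.ne_bot) (nonempty_of_measure_ne_zero hs.ne_bot)
    _ ≤ volume (A + B) := measure_mono (Set.add_subset_add hKA hLB)

theorem MeasurableSet.volume_weighted_add_le {p q : ℝ} (hp : 0 < p) (hq : 0 < q)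
    {A B : Set ℝ} (hA : MeasurableSet A)
    (hB : MeasurableSet B) (hAne : A.Nonempty) (hBne : B.Nonempty) :
    ENNReal.ofReal p * volume A + ENNReal.ofReal q * volume B ≤ volume (p • A + q • B) := by
  have := (hA.const_smul₀ p).volume_add_volume_le (hB.const_smul₀ q) hAne.smul_set hBne.smul_set
  simpa [Measure.addHaar_smul, abs_of_pos hp, abs_of_pos hq] using this

open scoped ENNReal in
theorem lintegral_eq_lintegral_volume_lt_toReal {f : ℝ → ℝ≥0∞} (hf : Measurable f)
    (hf1 : ∀ x, f x ≤ 1) :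
    ∫⁻ x, f x = ∫⁻ s in Set.Ioi (0 : ℝ), volume {x | s < (f x).toReal} := by
  rw [← lintegral_eq_lintegral_meas_lt _ (Filter.Eventually.of_forall fun x => by simp)
    hf.ennreal_toReal.aemeasurable]
  exact lintegral_congr fun x =>
    (ENNReal.ofReal_toReal ((hf1 x).trans_lt ENNReal.one_lt_top).ne).symm

open scoped ENNReal in
theorem lintegral_weighted_add_le_of_iSup_eq_one {p q : ℝ} (hp : 0 < p) (hq : 0 < q)
    (hpq : p + q = 1) {f g h : ℝ → ℝ≥0∞} (hf : Measurable f) (hg : Measurable g)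
    (hh : Measurable h) (hf1 : ⨆ x, f x = 1) (hg1 : ⨆ x, g x = 1)
    (hfgh : ∀ x y, f x ^ p * g y ^ q ≤ h (p • x + q • y)) :
    ENNReal.ofReal p * (∫⁻ x, f x) + ENNReal.ofReal q * (∫⁻ x, g x) ≤ ∫⁻ x, h x := by
  have hf_le : ∀ x, f x ≤ 1 := fun x => hf1 ▸ le_iSup f x
  have hg_le : ∀ x, g x ≤ 1 := fun x => hg1 ▸ le_iSup g x
  have hlt : ∀ {u : ℝ → ℝ≥0∞} {s : ℝ}, 0 < s → (∀ x, u x ≤ 1) → ∀ x,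
      (s < (u x).toReal ↔ ENNReal.ofReal s < u x) := fun hs hu x =>
    (ENNReal.ofReal_lt_iff_lt_toReal hs.le ((hu x).trans_lt ENNReal.one_lt_top).ne).symm
  have hm_le : ∀ x, min (h x) 1 ≤ 1 := fun x => min_le_right _ _
  refine le_trans ?_ (lintegral_mono fun x => min_le_left (h x) 1)
  rw [lintegral_eq_lintegral_volume_lt_toReal hf hf_le,
    lintegral_eq_lintegral_volume_lt_toReal hg hg_le,
    lintegral_eq_lintegral_volume_lt_toReal (hh.min measurable_const) hm_le,
    ← lintegral_const_mul' _ _ ENNReal.ofReal_ne_top,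
    ← lintegral_const_mul' _ _ ENNReal.ofReal_ne_top]
  refine (le_lintegral_add _ _).trans (setLIntegral_mono' measurableSet_Ioi fun s hs => ?_)
  have hs : 0 < s := hs
  simp only [hlt hs hf_le, hlt hs hg_le, hlt hs hm_le]
  rcases lt_or_ge s 1 with hs1 | hs1
  · have hs1' : ENNReal.ofReal s < 1 := by simpa using hs1
    have hA : {x | ENNReal.ofReal s < f x}.Nonempty :=
      lt_iSup_iff.1 (hf1.symm ▸ hs1' : _ < ⨆ x, f x)
    have hB : {x | ENNReal.ofReal s < g x}.Nonempty :=
      lt_iSup_iff.1 (hg1.symm ▸ hs1' : _ < ⨆ x, g x)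
    refine ((measurableSet_lt measurable_const hf).volume_weighted_add_le hp hq
      (measurableSet_lt measurable_const hg) hA hB).trans (measure_mono ?_)
    rintro _ ⟨_, ⟨x, hx, rfl⟩, _, ⟨y, hy, rfl⟩, rfl⟩
    refine lt_min (lt_of_lt_of_le ?_ (hfgh x y)) hs1'
    calc ENNReal.ofReal s = ENNReal.ofReal s ^ p * ENNReal.ofReal s ^ q := by
          rw [← ENNReal.rpow_add _ _ (by simpa using hs) ENNReal.ofReal_ne_top, hpq,
            ENNReal.rpow_one]
      _ < f x ^ p * g y ^ q := ENNReal.mul_lt_mul (ENNReal.rpow_lt_rpow hx hp)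
          (ENNReal.rpow_lt_rpow hy hq)
  · have hs1' : 1 ≤ ENNReal.ofReal s := by simpa using hs1
    simp [((hf_le _).trans hs1').not_gt, ((hg_le _).trans hs1').not_gt]

open scoped ENNReal in
theorem prekopa_leindler_real_of_bounded {p q : ℝ} (hp : 0 < p) (hq : 0 < q)
    (hpq : p + q = 1) {f g h : ℝ → ℝ≥0∞} (hf : Measurable f) (hg : Measurable g)
    (hh : Measurable h) (hf_top : ⨆ x, f x ≠ ⊤) (hg_top : ⨆ x, g x ≠ ⊤)
    (hfgh : ∀ x y, f x ^ p * g y ^ q ≤ h (p • x + q • y)) :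
    (∫⁻ x, f x) ^ p * (∫⁻ x, g x) ^ q ≤ ∫⁻ x, h x := by
  set a := ⨆ x, f x with ha
  set b := ⨆ x, g x with hb
  rcases eq_or_ne a 0 with ha0 | ha0
  · simp [ENNReal.iSup_eq_zero.1 (ha ▸ ha0), hp]
  rcases eq_or_ne b 0 with hb0 | hb0
  · simp [ENNReal.iSup_eq_zero.1 (hb ▸ hb0), hq]
  have hmul : ∀ x y : ℝ≥0∞, (a⁻¹ * x) ^ p * (b⁻¹ * y) ^ q =
      (a⁻¹ ^ p * b⁻¹ ^ q) * (x ^ p * y ^ q) := fun x y => by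
    rw [ENNReal.mul_rpow_of_nonneg _ _ hp.le, ENNReal.mul_rpow_of_nonneg _ _ hq.le]
    ring
  have hap : a⁻¹ ^ p ≠ 0 := (ENNReal.rpow_pos (by simpa using hf_top.lt_top.ne) (by simpa)).ne'
  have hbq : b⁻¹ ^ q ≠ 0 := (ENNReal.rpow_pos (by simpa using hg_top.lt_top.ne) (by simpa)).ne'
  have hc_top : a⁻¹ ^ p * b⁻¹ ^ q ≠ ⊤ := ENNReal.mul_ne_top
    (ENNReal.rpow_ne_top_of_nonneg hp.le (by simpa))
    (ENNReal.rpow_ne_top_of_nonneg hq.le (by simpa))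
  rw [← ENNReal.mul_le_mul_iff_right (mul_ne_zero hap hbq) hc_top, ← hmul,
    ← lintegral_const_mul _ hf, ← lintegral_const_mul _ hg, ← lintegral_const_mul _ hh]
  refine (ENNReal.rpow_mul_rpow_le_weighted_add hp hq hpq _ _).trans
    (lintegral_weighted_add_le_of_iSup_eq_one hp hq hpq (hf.const_mul _) (hg.const_mul _)
      (hh.const_mul _) ?_ ?_ fun x y => ?_)
  · rw [← ENNReal.mul_iSup, ENNReal.inv_mul_cancel ha0 hf_top]
  · rw [← ENNReal.mul_iSup, ENNReal.inv_mul_cancel hb0 hg_top]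
  · rw [hmul]
    gcongr
    exact hfgh x y

open scoped ENNReal in
theorem lintegral_rpow_eq_iSup_lintegral_min_rpow {r : ℝ} (hr : 0 < r) {f : ℝ → ℝ≥0∞}
    (hf : Measurable f) :
    (∫⁻ x, f x) ^ r = ⨆ N : ℕ, (∫⁻ x, min (f x) N) ^ r := by
  have hmono : ∀ x, Monotone fun N : ℕ => min (f x) N := fun x M N hMN =>
    min_le_min_left _ (by exact_mod_cast hMN)
  have hlim : Filter.Tendsto (fun N : ℕ => ∫⁻ x, min (f x) N) Filter.atTop
      (nhds (∫⁻ x, f x)) := by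
    refine lintegral_tendsto_of_tendsto_of_monotone
      (fun N => (hf.min measurable_const).aemeasurable)
      (Filter.Eventually.of_forall hmono) (Filter.Eventually.of_forall fun x => ?_)
    simpa using (tendsto_const_nhds (x := f x)).min ENNReal.tendsto_nat_nhds_top
  rw [← iSup_eq_of_tendsto (fun M N hMN => lintegral_mono fun x => hmono x hMN) hlim]
  exact (ENNReal.orderIsoRpow r hr).map_iSup _

open scoped ENNReal in
/-- One-dimensional Prékopa–Leindler inequality. -/
theorem prekopa_leindler_real {p q : ℝ} (hp : 0 < p) (hq : 0 < q)
    (hpq : p + q = 1) {f g h : ℝ → ℝ≥0∞} (hf : Measurable f) (hg : Measurable g)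
    (hh : Measurable h) (hfgh : ∀ x y, f x ^ p * g y ^ q ≤ h (p • x + q • y)) :
    (∫⁻ x, f x) ^ p * (∫⁻ x, g x) ^ q ≤ ∫⁻ x, h x := by
  have hbdd : ∀ (u : ℝ → ℝ≥0∞) (N : ℕ), ⨆ x, min (u x) N ≠ ⊤ := fun u N =>
    ((iSup_le fun x => min_le_right _ _).trans_lt (ENNReal.natCast_lt_top N)).ne
  have key : ∀ M N : ℕ, (∫⁻ x, min (f x) M) ^ p * (∫⁻ x, min (g x) N) ^ q ≤ ∫⁻ x, h x :=
    fun M N => prekopa_leindler_real_of_bounded hp hq hpq (hf.min measurable_const)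
      (hg.min measurable_const) hh (hbdd f M) (hbdd g N) fun x y => le_trans
        (by gcongr <;> exact min_le_left _ _) (hfgh x y)
  rw [lintegral_rpow_eq_iSup_lintegral_min_rpow hp hf,
    lintegral_rpow_eq_iSup_lintegral_min_rpow hq hg, ENNReal.iSup_mul]
  refine iSup_le fun M => ?_
  rw [ENNReal.mul_iSup]
  exact iSup_le (key M)

open scoped ENNReal in
/-- The Prékopa–Leindler inequality in `ℝⁿ`. -/
theorem prekopa_leindler {p q : ℝ} (hp : 0 < p) (hq : 0 < q) (hpq : p + q = 1) {n : ℕ}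
    {f g h : (Fin n → ℝ) → ℝ≥0∞} (hf : Measurable f) (hg : Measurable g)
    (hh : Measurable h) (hfgh : ∀ x y, f x ^ p * g y ^ q ≤ h (p • x + q • y)) :
    (∫⁻ x, f x) ^ p * (∫⁻ x, g x) ^ q ≤ ∫⁻ x, h x := by
  induction n with
  | zero =>
    have := hfgh default default
    rw [Subsingleton.elim (p • default + q • default) (default : Fin 0 → ℝ)] at this
    simp only [lintegral_unique, volume_pi, Measure.pi_empty_univ, mul_one]
    convert this
  | succ n ih =>
    let e := (MeasurableEquiv.piFinSuccAbove (fun _ : Fin (n + 1) => ℝ) 0).symm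
    have he : MeasurePreserving e := (volume_preserving_piFinSuccAbove _ 0).symm
    have hint : ∀ {u : (Fin (n + 1) → ℝ) → ℝ≥0∞}, Measurable u →
        ∫⁻ x, u x = ∫⁻ s : ℝ, ∫⁻ y : Fin n → ℝ, u (e (s, y)) := fun hu => by
      rw [← he.lintegral_comp hu]
      exact lintegral_prod _ (hu.comp e.measurable).aemeasurable
    have he_add : ∀ (s t : ℝ) (x y : Fin n → ℝ),
        e (p • s + q • t, p • x + q • y) = p • e (s, x) + q • e (t, y) := fun s t x y => by
      ext i
      refine Fin.cases ?_ (fun j => ?_) i <;> simp [e, MeasurableEquiv.piFinSuccAbove]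
    rw [hint hf, hint hg, hint hh]
    have hsec : ∀ {u : (Fin (n + 1) → ℝ) → ℝ≥0∞}, Measurable u → ∀ s,
        Measurable fun y => u (e (s, y)) := fun hu s =>
      hu.comp (e.measurable.comp measurable_prodMk_left)
    refine prekopa_leindler_real hp hq hpq (hf.comp e.measurable).lintegral_prod_right'
      (hg.comp e.measurable).lintegral_prod_right' (hh.comp e.measurable).lintegral_prod_right'
      fun s t => ih (hsec hf s) (hsec hg t) (hsec hh _) fun x y => ?_
    rw [he_add]
    exact hfgh _ _

/-- Multiplicative Brunn–Minkowski inequality for compact sets of unit volume. -/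
theorem one_le_volume_of_volume_eq_one {p q : ℝ} (hp : 0 < p) (hq : 0 < q) (hpq : p + q = 1)
    {n : ℕ} {A B : Set (EuclideanSpace ℝ (Fin n))} (hA : IsCompact A) (hB : IsCompact B)
    (hA1 : volume A = 1) (hB1 : volume B = 1) : 1 ≤ volume (p • A + q • B) := by
  have hC := (hA.smul p).add (hB.smul q)
  have hint : ∀ {S : Set (EuclideanSpace ℝ (Fin n))}, MeasurableSet S →
      ∫⁻ x : Fin n → ℝ, S.indicator 1 (WithLp.toLp 2 x) = volume S := fun hS => by
    rw [(PiLp.volume_preserving_toLp (Fin n)).lintegral_comp (measurable_one.indicator hS),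
      lintegral_indicator_one hS]
  have hmeas : ∀ {S : Set (EuclideanSpace ℝ (Fin n))}, MeasurableSet S →
      Measurable fun x : Fin n → ℝ =>
        S.indicator (1 : EuclideanSpace ℝ (Fin n) → ENNReal) (WithLp.toLp 2 x) :=
    fun hS => (measurable_one.indicator hS).comp (PiLp.volume_preserving_toLp (Fin n)).measurable
  have := prekopa_leindler hp hq hpq (hmeas hA.measurableSet) (hmeas hB.measurableSet)
    (hmeas hC.measurableSet) fun x y => by
      by_cases hx : WithLp.toLp 2 x ∈ A
      · by_cases hy : WithLp.toLp 2 y ∈ B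
        · have : WithLp.toLp 2 (p • x + q • y) ∈ p • A + q • B :=
            ⟨_, ⟨_, hx, rfl⟩, _, ⟨_, hy, rfl⟩, rfl⟩
          simp only [Set.indicator_of_mem hx, Set.indicator_of_mem hy, Set.indicator_of_mem this]
          simp
        · simp [hy, hq]
      · simp [hx, hp]
  rwa [hint hA.measurableSet, hint hB.measurableSet, hint hC.measurableSet, hA1, hB1,
    ENNReal.one_rpow, ENNReal.one_rpow, one_mul] at this

theorem volume_smul_inv_rpow_eq_one {n : ℕ} (hn : 1 ≤ n) {A : Set (EuclideanSpace ℝ (Fin n))}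
    (hA : IsCompact A) (hA0 : volume A ≠ 0) :
    volume (((volume A).toReal ^ (n : ℝ)⁻¹)⁻¹ • A) = 1 := by
  have hpos : 0 < (volume A).toReal := ENNReal.toReal_pos hA0 hA.measure_lt_top.ne
  have hn0 : n ≠ 0 := by lia
  rw [Measure.addHaar_smul, finrank_euclideanSpace_fin, inv_pow,
    Real.rpow_inv_natCast_pow hpos.le hn0, abs_of_pos (inv_pos.2 hpos),
    ENNReal.ofReal_inv_of_pos hpos,
    ENNReal.ofReal_toReal hA.measure_lt_top.ne, ENNReal.inv_mul_cancel hA0 hA.measure_lt_top.ne]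

/-- (Brunn–Minkowski inequality) Let `Y₁, Y₂` be nonempty compact convex
subsets of `ℝⁿ` (`n ≥ 1`).  Then
`vol(Y₁ + Y₂)^{1/n} ≥ vol(Y₁)^{1/n} + vol(Y₂)^{1/n}`, where `vol` is `n`-dimensional
Lebesgue measure and `Y₁ + Y₂` is the Minkowski sum. -/
theorem brunn_minkowski
    {n : ℕ} (hn : 1 ≤ n)
    (Y₁ Y₂ : Set (EuclideanSpace ℝ (Fin n)))
    (h1ne : Y₁.Nonempty) (h2ne : Y₂.Nonempty)
    (h1c : IsCompact Y₁) (h2c : IsCompact Y₂)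
    (h1v : Convex ℝ Y₁) (h2v : Convex ℝ Y₂) :
    (volume Y₁).toReal ^ ((n : ℝ)⁻¹) + (volume Y₂).toReal ^ ((n : ℝ)⁻¹) ≤
      (volume (Y₁ + Y₂)).toReal ^ ((n : ℝ)⁻¹) := by
  have hn0 : n ≠ 0 := by lia
  have hn0' : (n : ℝ)⁻¹ ≠ 0 := by positivity
  have hS := (h1c.add h2c).measure_lt_top (μ := volume).ne
  obtain ⟨y₁, hy₁⟩ := h1ne
  obtain ⟨y₂, hy₂⟩ := h2ne
  rcases eq_or_ne (volume Y₁) 0 with h1 | h1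
  · rw [h1, ENNReal.toReal_zero, Real.zero_rpow hn0', zero_add]
    refine Real.rpow_le_rpow ENNReal.toReal_nonneg (ENNReal.toReal_mono hS ?_) (by positivity)
    calc volume Y₂ = volume (y₁ +ᵥ Y₂) := by simp
      _ ≤ _ := measure_mono (by rintro _ ⟨y, hy, rfl⟩; exact ⟨y₁, hy₁, y, hy, rfl⟩)
  rcases eq_or_ne (volume Y₂) 0 with h2 | h2
  · rw [h2, ENNReal.toReal_zero, Real.zero_rpow hn0', add_zero]
    refine Real.rpow_le_rpow ENNReal.toReal_nonneg (ENNReal.toReal_mono hS ?_) (by positivity)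
    calc volume Y₁ = volume (y₂ +ᵥ Y₁) := by simp
      _ ≤ _ := measure_mono (by rintro _ ⟨y, hy, rfl⟩; exact ⟨y, hy, y₂, hy₂, add_comm _ _⟩)
  have h1' := volume_smul_inv_rpow_eq_one hn h1c h1
  have h2' := volume_smul_inv_rpow_eq_one hn h2c h2
  have ha : 0 < (volume Y₁).toReal ^ (n : ℝ)⁻¹ :=
    Real.rpow_pos_of_pos (ENNReal.toReal_pos h1 h1c.measure_lt_top.ne) _
  have hb : 0 < (volume Y₂).toReal ^ (n : ℝ)⁻¹ :=
    Real.rpow_pos_of_pos (ENNReal.toReal_pos h2 h2c.measure_lt_top.ne) _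
  set a := (volume Y₁).toReal ^ (n : ℝ)⁻¹
  set b := (volume Y₂).toReal ^ (n : ℝ)⁻¹
  have hab : 0 < a + b := add_pos ha hb
  have key := one_le_volume_of_volume_eq_one (div_pos ha hab) (div_pos hb hab)
    (by field_simp) (h1c.smul a⁻¹) (h2c.smul b⁻¹) h1' h2'
  have hset : (a / (a + b)) • a⁻¹ • Y₁ + (b / (a + b)) • b⁻¹ • Y₂ = (a + b)⁻¹ • (Y₁ + Y₂) := by
    rw [smul_smul, smul_smul, smul_add]
    congr 2 <;> field_simp
  rw [hset, Measure.addHaar_smul, finrank_euclideanSpace_fin, inv_pow,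
    abs_of_pos (by positivity), ENNReal.ofReal_inv_of_pos (by positivity),
    ← ENNReal.div_eq_inv_mul, ENNReal.le_div_iff_mul_le (by simp [hab]) (by simp), one_mul,
    ENNReal.ofReal_le_iff_le_toReal hS] at key
  exact (Real.le_rpow_inv_iff_of_pos hab.le ENNReal.toReal_nonneg (by positivity)).2
    (by exact_mod_cast key)
end
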